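/- arXiv:2001.03211 — 2 statements merged into one kernel-verified Lean document; each statement's English description precedes it below -/
import Mathlib

section
/- (Strong Law of Large Numbers) Under assumptions (A1)–(A4), let μ⋆ be the unique stationary Borel probability measure on (0,1). Then for every x ∈ (0,1) and every bounded continuous φ : (0,1) → ℝ, for ℙ_x-almost every ω ∈ Σ, (1/n)·∑_{k=1}^{n} φ(f^k_ω(x)) → ∫ φ dμ⋆ as n → ∞. -/
/-
Formalization of the Alsedà–Misiurewicz system setup:
`f0, f1` are the piecewise-linear interval homeomorphisms, `iter` the random
iteration along ω ∈ Σ = {0,1}^ℕ, `IsKernel` characterises the family x ↦ ℙ_x by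
its values on cylinder sets, `Pop` is the Markov operator (as a set function),
`Stationary` expresses P-invariance for probability measures on (0,1), `U` is
the dual operator, and `A1`–`A4` are the assumptions of the paper.
-/

open MeasureTheory Filter Set
open scoped ENNReal Topology

namespace AM

noncomputable def f0 (x₀ y₀ : ℝ) (x : ℝ) : ℝ :=
  if x ≤ x₀ then (y₀ / x₀) * x else ((1 - y₀) / (1 - x₀)) * (x - 1) + 1

noncomputable def f1 (x₀ y₀ : ℝ) (x : ℝ) : ℝ := 1 - f0 x₀ y₀ (1 - x)

/-- `fb b` is `f₁` if `b = true`, and `f₀` if `b = false`. -/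
noncomputable def fb (x₀ y₀ : ℝ) (b : Bool) : ℝ → ℝ :=
  if b then f1 x₀ y₀ else f0 x₀ y₀

/-- `iter x₀ y₀ ω n x = f^n_ω(x) = f_{ω (n-1)} ∘ ⋯ ∘ f_{ω 0} (x)`, with `f^0_ω = id`. -/
noncomputable def iter (x₀ y₀ : ℝ) (ω : ℕ → Bool) : ℕ → ℝ → ℝ
  | 0, x => x
  | n + 1, x => fb x₀ y₀ (ω n) (iter x₀ y₀ ω n x)

/-- `cylProb x₀ y₀ p₀ p₁ x w = p_{i₁}(x) p_{i₂}(f_{i₁} x) ⋯` for the word `w = (i₁, …, i_k)`. -/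
noncomputable def cylProb (x₀ y₀ : ℝ) (p₀ p₁ : ℝ → ℝ) : ℝ → List Bool → ℝ
  | _, [] => 1
  | x, b :: w => (if b then p₁ x else p₀ x) * cylProb x₀ y₀ p₀ p₁ (fb x₀ y₀ b x) w

/-- The cylinder set of sequences starting with the word `w`. -/
def cyl (w : List Bool) : Set (ℕ → Bool) := {ω | ∀ j : Fin w.length, ω j = w.get j}

/-- `IsKernel x₀ y₀ p₀ p₁ Pm` says that `Pm x = ℙ_x` for all `x ∈ (0,1)`, i.e. `Pm x` gives
every cylinder set its prescribed probability (this determines `Pm x` uniquely and makes it a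
probability measure, since the empty word gives `Pm x univ = 1`). -/
def IsKernel (x₀ y₀ : ℝ) (p₀ p₁ : ℝ → ℝ) (Pm : ℝ → Measure (ℕ → Bool)) : Prop :=
  ∀ x ∈ Ioo (0:ℝ) 1, ∀ w : List Bool,
    Pm x (cyl w) = ENNReal.ofReal (cylProb x₀ y₀ p₀ p₁ x w)

/-- The Markov operator `P`, as a set function:
`Pop μ A = ∫_{f₀⁻¹(A)} p₀ dμ + ∫_{f₁⁻¹(A)} p₁ dμ`. -/
noncomputable def Pop (x₀ y₀ : ℝ) (p₀ p₁ : ℝ → ℝ) (μ : Measure ℝ) (A : Set ℝ) : ℝ≥0∞ :=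
  (∫⁻ x in f0 x₀ y₀ ⁻¹' A, ENNReal.ofReal (p₀ x) ∂μ) +
    ∫⁻ x in f1 x₀ y₀ ⁻¹' A, ENNReal.ofReal (p₁ x) ∂μ

/-- A stationary (P-invariant) Borel probability measure on (0,1). -/
def Stationary (x₀ y₀ : ℝ) (p₀ p₁ : ℝ → ℝ) (μ : Measure ℝ) : Prop :=
  IsProbabilityMeasure μ ∧ μ (Ioo 0 1) = 1 ∧
    ∀ A : Set ℝ, MeasurableSet A → A ⊆ Ioo 0 1 → μ A = Pop x₀ y₀ p₀ p₁ μ A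

/-- The dual operator `Uφ(x) = p₀(x) φ(f₀ x) + p₁(x) φ(f₁ x)`. -/
noncomputable def U (x₀ y₀ : ℝ) (p₀ p₁ : ℝ → ℝ) (φ : ℝ → ℝ) : ℝ → ℝ :=
  fun x => p₀ x * φ (f0 x₀ y₀ x) + p₁ x * φ (f1 x₀ y₀ x)

/-- Assumption (A1): `1/2 < x₀ < 1` and `1/2 ≤ y₀ < x₀`. -/
def A1 (x₀ y₀ : ℝ) : Prop := 1/2 < x₀ ∧ x₀ < 1 ∧ 1/2 ≤ y₀ ∧ y₀ < x₀

/-- Assumption (A2): Dini continuity of `p₀, p₁`; `β` is a modulus of continuity for both, with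
`∑ₙ β(C tⁿ) < ∞` for all `C ≥ 0`, `0 < t < 1`. (Such a `β` exists iff the least modulus of
continuity has this summability property.) -/
def A2 (p₀ p₁ : ℝ → ℝ) : Prop :=
  ∃ β : ℝ → ℝ,
    (∀ t : ℝ, ∀ x ∈ Icc (0:ℝ) 1, ∀ y ∈ Icc (0:ℝ) 1, |x - y| ≤ t →
      |p₀ x - p₀ y| ≤ β t ∧ |p₁ x - p₁ y| ≤ β t) ∧
    (∀ C : ℝ, 0 ≤ C → ∀ t : ℝ, 0 < t → t < 1 → Summable fun n : ℕ => β (C * t ^ n))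

/-- Assumption (A3): `p₀, p₁` are continuous, `p₀ + p₁ = 1`, and `0 < pᵢ < 1` on `[0,1]`. -/
def A3 (p₀ p₁ : ℝ → ℝ) : Prop :=
  ContinuousOn p₀ (Icc 0 1) ∧ ContinuousOn p₁ (Icc 0 1) ∧
    ∀ x ∈ Icc (0:ℝ) 1, p₀ x + p₁ x = 1 ∧ 0 < p₀ x ∧ p₀ x < 1 ∧ 0 < p₁ x ∧ p₁ x < 1

/-- Assumption (A4): the average Lyapunov exponents at 0 and 1 are positive
(`a₀ = y₀/x₀`, `a₁ = (1-y₀)/(1-x₀)`). -/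
def A4 (x₀ y₀ : ℝ) (p₀ p₁ : ℝ → ℝ) : Prop :=
  0 < p₀ 0 * Real.log (y₀ / x₀) + p₁ 0 * Real.log ((1 - y₀) / (1 - x₀)) ∧
    0 < p₀ 1 * Real.log ((1 - y₀) / (1 - x₀)) + p₁ 1 * Real.log (y₀ / x₀)

end AM

namespace AM

/-! ### Averaging operators of finite systems of maps -/

section Avg

variable {Y ι : Type*} [Fintype ι]

/-- The averaging operator of the maps `F i`, chosen with the place-dependent weights `P i`. -/
def avg (P : ι → Y → ℝ) (F : ι → Y → Y) (G : Y → ℝ) (y : Y) : ℝ := ∑ i, P i y * G (F i y)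

/-- On the set `S`, which the maps preserve, the weights are a probability vector. -/
structure IsSystem (P : ι → Y → ℝ) (F : ι → Y → Y) (S : Set Y) : Prop where
  mapsTo : ∀ i, MapsTo (F i) S S
  nonneg : ∀ i, ∀ y ∈ S, 0 ≤ P i y
  sum_eq_one : ∀ y ∈ S, ∑ i, P i y = 1

variable {P : ι → Y → ℝ} {F : ι → Y → Y} {S : Set Y}

theorem avg_add (G H : Y → ℝ) : avg P F (G + H) = avg P F G + avg P F H := by
  ext y; simp [avg, mul_add, Finset.sum_add_distrib]

theorem avg_smul (c : ℝ) (G : Y → ℝ) : avg P F (c • G) = c • avg P F G := by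
  ext y; simp [avg, Finset.mul_sum, mul_left_comm]

theorem iterate_avg_add (n : ℕ) (G H : Y → ℝ) :
    (avg P F)^[n] (G + H) = (avg P F)^[n] G + (avg P F)^[n] H := by
  induction n generalizing G H with
  | zero => rfl
  | succ n ih => simp only [Function.iterate_succ_apply, avg_add, ih]

theorem iterate_avg_smul (n : ℕ) (c : ℝ) (G : Y → ℝ) :
    (avg P F)^[n] (c • G) = c • (avg P F)^[n] G := by
  induction n generalizing G with
  | zero => rfl
  | succ n ih => simp only [Function.iterate_succ_apply, avg_smul, ih]

theorem iterate_avg_sub (n : ℕ) (G H : Y → ℝ) :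
    (avg P F)^[n] (G - H) = (avg P F)^[n] G - (avg P F)^[n] H := by
  rw [sub_eq_add_neg, ← neg_one_smul ℝ H, iterate_avg_add, iterate_avg_smul, neg_one_smul,
    ← sub_eq_add_neg]

namespace IsSystem

theorem avg_le (h : IsSystem P F S) {G H : Y → ℝ} (hGH : ∀ y ∈ S, G y ≤ H y) :
    ∀ y ∈ S, avg P F G y ≤ avg P F H y := fun y hy =>
  Finset.sum_le_sum fun i _ =>
    mul_le_mul_of_nonneg_left (hGH _ (h.mapsTo i hy)) (h.nonneg i y hy)

theorem iterate_avg_le (h : IsSystem P F S) (n : ℕ) {G H : Y → ℝ} (hGH : ∀ y ∈ S, G y ≤ H y) :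
    ∀ y ∈ S, (avg P F)^[n] G y ≤ (avg P F)^[n] H y := by
  induction n with
  | zero => exact hGH
  | succ n ih => simpa only [Function.iterate_succ_apply'] using h.avg_le ih

theorem avg_const (h : IsSystem P F S) (c : ℝ) : ∀ y ∈ S, avg P F (fun _ => c) y = c := by
  intro y hy
  simp [avg, ← Finset.sum_mul, h.sum_eq_one y hy]

theorem iterate_avg_const (h : IsSystem P F S) (n : ℕ) (c : ℝ) :
    ∀ y ∈ S, (avg P F)^[n] (fun _ => c) y = c := by
  induction n with
  | zero => intro y _; rfl
  | succ n ih =>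
    intro y hy
    rw [Function.iterate_succ_apply']
    refine Eq.trans ?_ (h.avg_const c y hy)
    exact le_antisymm (h.avg_le (fun z hz => (ih z hz).le) y hy)
      (h.avg_le (fun z hz => (ih z hz).ge) y hy)

theorem iterate_avg_le_of_drift (h : IsSystem P F S) {V : Y → ℝ} {q B : ℝ} (hq0 : 0 ≤ q)
    (hq : q < 1) (hB : 0 ≤ B) (hV : ∀ y ∈ S, avg P F V y ≤ q * V y + B) (n : ℕ) :
    ∀ y ∈ S, (avg P F)^[n] V y ≤ q ^ n * V y + B / (1 - q) := by
  have hB' : 0 ≤ B / (1 - q) := div_nonneg hB (by linarith)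
  induction n with
  | zero => intro y _; simpa using hB'
  | succ n ih =>
    intro y hy
    rw [Function.iterate_succ_apply]
    have h1 := h.iterate_avg_le n (H := q • V + fun _ => B) hV y hy
    rw [iterate_avg_add, iterate_avg_smul, Pi.add_apply, Pi.smul_apply,
      h.iterate_avg_const n _ y hy, smul_eq_mul] at h1
    have h2 : B + q * (B / (1 - q)) = B / (1 - q) := by
      have : (1 - q) ≠ 0 := by linarith
      field_simp
      ring
    have h3 : q * (avg P F)^[n] V y ≤ q * (q ^ n * V y + B / (1 - q)) := by
      gcongr
      exact ih y hy
    rw [pow_succ]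
    linarith

theorem sq_avg_le (h : IsSystem P F S) (G : Y → ℝ) :
    ∀ y ∈ S, avg P F G y ^ 2 ≤ avg P F (fun z => G z ^ 2) y := fun y hy =>
  Real.pow_arith_mean_le_arith_mean_pow_of_even _ _ _ (fun i _ => h.nonneg i y hy)
    (h.sum_eq_one y hy) even_two

/-- Nonnegative functions are bounded below along a composition of two of the maps. -/
theorem le_iterate_avg (h : IsSystem P F S) {p : ℝ} (hp : 0 ≤ p)
    (hpP : ∀ i, ∀ y ∈ S, p ≤ P i y) (i j : ι) (n : ℕ) {H : Y → ℝ} (hH : ∀ y ∈ S, 0 ≤ H y) :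
    ∀ y ∈ S, (p ^ 2) ^ n * H ((F j ∘ F i)^[n] y) ≤ (avg P F)^[2 * n] H y := by
  have key : ∀ (k : ι) (G : Y → ℝ), (∀ y ∈ S, 0 ≤ G y) → ∀ y ∈ S,
      p * G (F k y) ≤ avg P F G y := by
    intro k G hG y hy
    calc p * G (F k y) ≤ P k y * G (F k y) :=
          mul_le_mul_of_nonneg_right (hpP k y hy) (hG _ (h.mapsTo k hy))
      _ ≤ avg P F G y := Finset.single_le_sum (f := fun i => P i y * G (F i y))
          (fun i _ => mul_nonneg (h.nonneg i y hy) (hG _ (h.mapsTo i hy))) (Finset.mem_univ k)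
  have hpos : ∀ m, ∀ y ∈ S, 0 ≤ (avg P F)^[m] H y := by
    intro m y hy
    simpa [h.iterate_avg_const m 0 y hy] using
      h.iterate_avg_le m (G := fun _ => 0) hH y hy
  induction n with
  | zero => intro y _; simp
  | succ n ih =>
    intro y hy
    have h1 := ih _ (h.mapsTo j (h.mapsTo i hy))
    have h2 := key j _ (hpos (2 * n)) _ (h.mapsTo i hy)
    have h3 := key i ((avg P F) ((avg P F)^[2 * n] H)) (by
      simpa only [Function.iterate_succ_apply'] using hpos (2 * n + 1)) y hy
    rw [show 2 * (n + 1) = 2 * n + 1 + 1 by ring, Function.iterate_succ_apply' (avg P F),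
      Function.iterate_succ_apply' (avg P F), Function.iterate_succ_apply (F j ∘ F i)]
    calc (p ^ 2) ^ (n + 1) * H ((F j ∘ F i)^[n] ((F j ∘ F i) y))
        = p * (p * ((p ^ 2) ^ n * H ((F j ∘ F i)^[n] (F j (F i y))))) := by
          rw [Function.comp_apply]; ring
      _ ≤ p * (p * (avg P F)^[2 * n] H (F j (F i y))) := by gcongr
      _ ≤ p * (avg P F ((avg P F)^[2 * n] H) (F i y)) := by gcongr
      _ ≤ _ := h3

/-- A discrete Duhamel inequality. -/
theorem le_iterate_avg_add_sum (h : IsSystem P F S) {G : ℕ → Y → ℝ} {b : Y → ℝ}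
    (hG : ∀ n, ∀ y ∈ S, G (n + 1) y ≤ avg P F (G n) y + b y) (n : ℕ) :
    ∀ y ∈ S, G n y ≤ (avg P F)^[n] (G 0) y + ∑ k ∈ Finset.range n, (avg P F)^[k] b y := by
  have hsum : ∀ n, avg P F (∑ k ∈ Finset.range n, (avg P F)^[k] b) =
      ∑ k ∈ Finset.range n, (avg P F)^[k + 1] b := by
    intro n
    ext y
    simp only [avg, Function.iterate_succ_apply', Finset.sum_apply, Finset.mul_sum]
    exact Finset.sum_comm
  induction n with
  | zero => intro y _; simp
  | succ n ih =>
    intro y hy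
    have h1 := h.avg_le (H := (avg P F)^[n] (G 0) + ∑ k ∈ Finset.range n, (avg P F)^[k] b)
      (fun z hz => by simpa using ih z hz) y hy
    rw [avg_add, hsum, ← Function.iterate_succ_apply' (f := avg P F)] at h1
    rw [Finset.sum_range_succ']
    have h2 := hG n y hy
    simp only [Pi.add_apply, Finset.sum_apply] at h1
    simp only [Function.iterate_zero, id_eq]
    linarith

end IsSystem

end Avg

/-- A drift condition and a uniform loss of mass on a sublevel set of `V` make the weight
`1 + θ V` decrease geometrically. Here `u` and `v` stand for the images of `1` and `V`. -/
theorem exists_weight_contraction {q B κ R : ℝ} (hq0 : 0 ≤ q) (hq : q < 1) (hB : 0 ≤ B)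
    (hκ : 0 < κ) (hR1 : 1 ≤ R) (hR : 2 * B ≤ (1 - q) * R) :
    ∃ θ > 0, ∃ r, 0 < r ∧ r < 1 ∧ ∀ V u v : ℝ, 0 ≤ V → u ≤ 1 → v ≤ q * V + B →
      (V ≤ R → u ≤ 1 - κ) → u + θ * v ≤ r * (1 + θ * V) := by
  set θ := κ / (2 * (B + 1)) with hθ
  have hθ0 : 0 < θ := by positivity
  have hθB : θ * B ≤ κ / 2 := by
    rw [hθ, div_mul_eq_mul_div, div_le_div_iff₀ (by positivity) (by positivity)]
    nlinarith
  set ρ := (1 + θ * ((1 + q) / 2)) / (1 + θ) with hρ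
  have hρ0 : 0 < ρ := by positivity
  have hρ1 : ρ < 1 := by
    rw [hρ, div_lt_one (by positivity)]
    nlinarith
  have hρ' : 1 + θ * ((1 + q) / 2) = ρ * (1 + θ) := by rw [hρ]; field_simp
  have hqρ : (1 + q) / 2 ≤ ρ := by
    rw [hρ, le_div_iff₀ (by positivity)]
    nlinarith
  refine ⟨θ, hθ0, max (max (1 - κ / 2) q) ρ, by positivity, by simp; grind, ?_⟩
  intro V u v hV hu hv hVR
  have hm1 : 1 - κ / 2 ≤ max (max (1 - κ / 2) q) ρ := by simp
  have hm2 : q ≤ max (max (1 - κ / 2) q) ρ := by simp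
  have hm3 : ρ ≤ max (max (1 - κ / 2) q) ρ := by simp
  set r := max (max (1 - κ / 2) q) ρ
  have hv' : θ * v ≤ θ * (q * V + B) := by gcongr
  have hθV : 0 ≤ θ * V := by positivity
  rcases le_or_gt V R with h | h
  · have := hVR h
    have : q * (θ * V) ≤ r * (θ * V) := by gcongr
    nlinarith
  · have h1 : q * V + B ≤ (1 + q) / 2 * V := by nlinarith
    have h2 : θ * v ≤ θ * ((1 + q) / 2 * V) := by
      refine hv'.trans ?_
      gcongr
    have h3 : 1 + θ * ((1 + q) / 2 * V) ≤ ρ * (1 + θ * V) := by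
      have : θ * (V - 1) * ((1 + q) / 2) ≤ θ * (V - 1) * ρ := by
        have : 0 ≤ θ * (V - 1) := mul_nonneg hθ0.le (by linarith)
        gcongr
      linarith
    have h4 : ρ * (1 + θ * V) ≤ r * (1 + θ * V) := by gcongr
    linarith

/-- A sequence that decreases by a fixed factor every `m` steps decreases geometrically. -/
theorem exists_geometric_bound {r C : ℝ} {m : ℕ} (hm : 0 < m) (hr0 : 0 < r) (hr : r < 1)
    (hC : 0 ≤ C) :
    ∃ l, 0 < l ∧ l < 1 ∧ ∀ d : ℕ → ℝ, 0 ≤ d 0 → (∀ k, d (k + m) ≤ r * d k) →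
      (∀ k, d k ≤ C * d 0) → ∀ k, d k ≤ C / r * l ^ k * d 0 := by
  have hm' : (m : ℝ) ≠ 0 := by positivity
  refine ⟨r ^ (1 / (m : ℝ)), by positivity, Real.rpow_lt_one hr0.le hr (by positivity), ?_⟩
  set l := r ^ (1 / (m : ℝ)) with hl
  have hlm : l ^ m = r := by
    rw [hl, ← Real.rpow_natCast, ← Real.rpow_mul hr0.le, one_div, inv_mul_cancel₀ hm',
      Real.rpow_one]
  have hl0 : 0 < l := by positivity
  have hl1 : l ≤ 1 := Real.rpow_le_one hr0.le hr.le (by positivity)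
  intro d hd0 hd hdC k
  induction k using Nat.strong_induction_on with
  | _ k ih =>
    rcases lt_or_ge k m with h | h
    · refine (hdC k).trans ?_
      have : r ≤ l ^ k := hlm ▸ pow_le_pow_of_le_one hl0.le hl1 h.le
      have : C ≤ C / r * l ^ k := by
        rw [div_mul_eq_mul_div, le_div_iff₀ hr0]
        gcongr
      gcongr
    · obtain ⟨j, rfl⟩ := Nat.exists_eq_add_of_le' h
      calc d (j + m) ≤ r * d j := hd j
        _ ≤ r * (C / r * l ^ j * d 0) := by gcongr; exact ih j (by omega)
        _ = C / r * l ^ (j + m) * d 0 := by rw [pow_add, hlm]; ring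

/-! ### A strong law of large numbers for orthogonal increments -/

section Orthogonal

variable {Ω : Type*} [MeasurableSpace Ω] {P : Measure Ω}

theorem ae_tendsto_zero_of_summable_integral {Y : ℕ → Ω → ℝ} (hY : ∀ m, Integrable (Y m) P)
    (hY0 : ∀ m ω, 0 ≤ Y m ω) (hs : Summable fun m => ∫ ω, Y m ω ∂P) :
    ∀ᵐ ω ∂P, Tendsto (fun m => Y m ω) atTop (𝓝 0) := by
  have h1 : ∫⁻ ω, ∑' m, ENNReal.ofReal (Y m ω) ∂P ≠ ∞ := by
    rw [lintegral_tsum fun m => (hY m).aestronglyMeasurable.aemeasurable.ennreal_ofReal]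
    simp_rw [← ofReal_integral_eq_lintegral_ofReal (hY _) (ae_of_all _ (hY0 _))]
    exact hs.tsum_ofReal_ne_top
  filter_upwards [ae_lt_top' (AEMeasurable.tsum
    fun m => (hY m).aestronglyMeasurable.aemeasurable.ennreal_ofReal) h1] with ω hω
  have h2 := (ENNReal.tendsto_toReal ENNReal.zero_ne_top).comp
    (ENNReal.tendsto_atTop_zero_of_tsum_ne_top hω.ne)
  refine h2.congr fun m => ?_
  simp [hY0 m ω]

theorem tendsto_average_of_orthogonal {d : ℕ → Ω → ℝ} {C : ℝ}
    (hint : ∀ i j, Integrable (fun ω => d i ω * d j ω) P)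
    (horth : ∀ i j, i < j → ∫ ω, d i ω * d j ω ∂P = 0)
    (hC : ∀ i, ∫ ω, d i ω * d i ω ∂P ≤ C) :
    ∀ᵐ ω ∂P, Tendsto (fun n : ℕ => (∑ k ∈ Finset.range n, d k ω) / n) atTop (𝓝 0) := by
  have hC0 : 0 ≤ C := (integral_nonneg fun ω => mul_self_nonneg (d 0 ω)).trans (hC 0)
  set S : ℕ → Ω → ℝ := fun n ω => ∑ k ∈ Finset.range n, d k ω with hS
  have hSint : ∀ n, Integrable (fun ω => S n ω * S n ω) P := by
    intro n
    simp only [hS, Finset.sum_mul_sum]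
    exact integrable_finsetSum _ fun i _ => integrable_finsetSum _ fun j _ => hint i j
  have hSle : ∀ n : ℕ, ∫ ω, S n ω * S n ω ∂P ≤ C * n := by
    intro n
    simp only [hS, Finset.sum_mul_sum]
    rw [integral_finsetSum _ fun i _ => integrable_finsetSum _ fun j _ => hint i j]
    calc _ = ∑ i ∈ Finset.range n, ∫ ω, d i ω * d i ω ∂P := by
          refine Finset.sum_congr rfl fun i hi => ?_
          rw [integral_finsetSum _ fun j _ => hint i j]
          refine Finset.sum_eq_single_of_mem i hi fun j _ hj => ?_
          rcases lt_or_gt_of_ne hj with h | h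
          · simpa only [mul_comm] using horth j i h
          · exact horth i j h
      _ ≤ ∑ i ∈ Finset.range n, C := Finset.sum_le_sum fun i _ => hC i
      _ = C * n := by simp [mul_comm]
  set Y : ℕ → Ω → ℝ := fun m ω => (S ((m + 1) ^ 2) ω * S ((m + 1) ^ 2) ω) / ((m : ℝ) + 1) ^ 4
    with hYdef
  set Z : ℕ → Ω → ℝ := fun m ω =>
    ((2 * m + 3) * ∑ k ∈ Finset.Ico ((m + 1) ^ 2) ((m + 2) ^ 2), d k ω * d k ω) /
      ((m : ℝ) + 1) ^ 4 with hZdef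
  have hsum2 : Summable fun m : ℕ => 1 / ((m : ℝ) + 1) ^ 2 := by
    have := (summable_nat_add_iff 1).2 (Real.summable_one_div_nat_pow.2 one_lt_two)
    simpa using this
  have hY : ∀ᵐ ω ∂P, Tendsto (fun m => Y m ω) atTop (𝓝 0) := by
    refine ae_tendsto_zero_of_summable_integral (fun m => (hSint _).div_const _)
      (fun m ω => div_nonneg (mul_self_nonneg _) (by positivity)) ?_
    refine Summable.of_nonneg_of_le (fun m => integral_nonneg fun ω =>
      div_nonneg (mul_self_nonneg _) (by positivity)) (fun m => ?_) (hsum2.mul_left C)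
    simp only [hYdef]
    rw [integral_div, div_le_iff₀ (by positivity)]
    refine (hSle _).trans (le_of_eq ?_)
    push_cast
    field_simp
  have hZint : ∀ m, Integrable (Z m) P := fun m =>
    ((integrable_finsetSum _ fun k _ => hint k k).const_mul _).div_const _
  have hZ0 : ∀ m ω, 0 ≤ Z m ω := fun m ω => div_nonneg (mul_nonneg (by positivity)
    (Finset.sum_nonneg fun k _ => mul_self_nonneg _)) (by positivity)
  have hZ : ∀ᵐ ω ∂P, Tendsto (fun m => Z m ω) atTop (𝓝 0) := by
    refine ae_tendsto_zero_of_summable_integral hZint hZ0 ?_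
    refine Summable.of_nonneg_of_le (fun m => integral_nonneg (hZ0 m)) (fun m => ?_)
      (hsum2.mul_left (9 * C))
    simp only [hZdef]
    rw [integral_div, integral_const_mul, integral_finsetSum _ fun k _ => hint k k,
      div_le_iff₀ (by positivity)]
    have h1 : ∑ k ∈ Finset.Ico ((m + 1) ^ 2) ((m + 2) ^ 2), ∫ ω, d k ω * d k ω ∂P
        ≤ (2 * m + 3) * C := by
      refine (Finset.sum_le_sum fun k _ => hC k).trans (le_of_eq ?_)
      rw [Finset.sum_const, Nat.card_Ico, nsmul_eq_mul,
        show (m + 2) ^ 2 - (m + 1) ^ 2 = 2 * m + 3 by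
          rw [Nat.sub_eq_iff_eq_add (by gcongr; omega)]; ring]
      push_cast
      rfl
    calc _ ≤ (2 * (m : ℝ) + 3) * ((2 * m + 3) * C) := by gcongr
      _ ≤ (3 * ((m : ℝ) + 1)) * ((3 * (m + 1)) * C) := by gcongr <;> linarith
      _ = 9 * C * (1 / ((m : ℝ) + 1) ^ 2) * ((m : ℝ) + 1) ^ 4 := by field_simp; ring
  filter_upwards [hY, hZ] with ω hYω hZω
  have hlim : Tendsto (fun m => √(Y m ω) + √(Z m ω)) atTop (𝓝 0) := by
    simpa using hYω.sqrt.add hZω.sqrt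
  have hsq : Tendsto (fun n : ℕ => Nat.sqrt n - 1) atTop atTop := by
    refine tendsto_atTop.2 fun b => ?_
    filter_upwards [eventually_ge_atTop ((b + 1) ^ 2)] with n hn
    have := Nat.le_sqrt'.2 hn
    omega
  refine squeeze_zero_norm' ?_ (hlim.comp hsq)
  filter_upwards [eventually_ge_atTop 1] with n hn
  obtain ⟨m, hm⟩ : ∃ m, Nat.sqrt n = m + 1 :=
    Nat.exists_eq_succ_of_ne_zero (Nat.sqrt_pos.2 hn).ne'
  have hmn : (m + 1) ^ 2 ≤ n := Nat.le_sqrt'.1 hm.ge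
  have hnm : n < (m + 2) ^ 2 := Nat.sqrt_lt'.1 (by omega)
  simp only [Function.comp_apply, hm, Nat.add_sub_cancel]
  have hmnR : ((m : ℝ) + 1) ^ 2 ≤ n := by exact_mod_cast hmn
  have hsplit : S n ω = S ((m + 1) ^ 2) ω + ∑ k ∈ Finset.Ico ((m + 1) ^ 2) n, d k ω := by
    simp only [hS]
    rw [Finset.sum_range_add_sum_Ico _ hmn]
  have hgap : |∑ k ∈ Finset.Ico ((m + 1) ^ 2) n, d k ω| ≤ √(Z m ω) * ((m : ℝ) + 1) ^ 2 := by
    refine abs_le_of_sq_le_sq ?_ (by positivity)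
    rw [mul_pow, Real.sq_sqrt (hZ0 m ω)]
    calc (∑ k ∈ Finset.Ico ((m + 1) ^ 2) n, d k ω) ^ 2
        ≤ (Finset.Ico ((m + 1) ^ 2) n).card * ∑ k ∈ Finset.Ico ((m + 1) ^ 2) n, d k ω ^ 2 :=
          sq_sum_le_card_mul_sum_sq
      _ ≤ (2 * m + 3) * ∑ k ∈ Finset.Ico ((m + 1) ^ 2) ((m + 2) ^ 2), d k ω * d k ω := by
          simp only [pow_two (d _ ω)]
          gcongr
          · exact Finset.sum_nonneg fun k _ => mul_self_nonneg _
          · rw [Nat.card_Ico]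
            have : n - (m + 1) ^ 2 ≤ 2 * m + 3 := by
              rw [Nat.sub_le_iff_le_add]; nlinarith
            exact_mod_cast this
          · exact fun _ _ _ => mul_self_nonneg _
      _ = Z m ω * (((m : ℝ) + 1) ^ 2) ^ 2 := by simp only [hZdef]; field_simp
  have hfirst : |S ((m + 1) ^ 2) ω| = √(Y m ω) * ((m : ℝ) + 1) ^ 2 := by
    simp only [hYdef]
    rw [Real.sqrt_div (mul_self_nonneg _), Real.sqrt_mul_self_eq_abs,
      show ((m : ℝ) + 1) ^ 4 = (((m : ℝ) + 1) ^ 2) ^ 2 by ring, Real.sqrt_sq (by positivity)]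
    field_simp
  have hn0 : (0 : ℝ) < n := by positivity
  rw [Real.norm_eq_abs, abs_div, abs_of_pos hn0, div_le_iff₀ hn0]
  calc |S n ω| ≤ √(Y m ω) * ((m : ℝ) + 1) ^ 2 + √(Z m ω) * ((m : ℝ) + 1) ^ 2 := by
        rw [hsplit, ← hfirst]
        exact (abs_add_le _ _).trans (by gcongr)
    _ = (√(Y m ω) + √(Z m ω)) * ((m : ℝ) + 1) ^ 2 := by ring
    _ ≤ _ := by gcongr

end Orthogonal

/-! ### Integration against the measures `ℙ_x` -/

section Kernel

variable {x₀ y₀ : ℝ} {p₀ p₁ : ℝ → ℝ} {Pm : ℝ → Measure (ℕ → Bool)} {x : ℝ}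

/-- The probability of choosing the map `fb x₀ y₀ b` at the point `x`. -/
def prob (p₀ p₁ : ℝ → ℝ) (b : Bool) (x : ℝ) : ℝ := if b then p₁ x else p₀ x

theorem cylProb_append_singleton (w : List Bool) (b : Bool) (x : ℝ) :
    cylProb x₀ y₀ p₀ p₁ x (w ++ [b]) = cylProb x₀ y₀ p₀ p₁ x w *
      prob p₀ p₁ b (w.foldl (fun y c => fb x₀ y₀ c y) x) := by
  induction w generalizing x with
  | nil => simp [cylProb, prob]
  | cons c w ih => simp only [List.cons_append, cylProb, ih, List.foldl_cons, mul_assoc]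

theorem foldl_ofFn (ω : ℕ → Bool) (n : ℕ) (x : ℝ) :
    (List.ofFn fun i : Fin n => ω i).foldl (fun y c => fb x₀ y₀ c y) x = iter x₀ y₀ ω n x := by
  induction n with
  | zero => rfl
  | succ n ih =>
    rw [List.ofFn_succ', List.concat_eq_append, List.foldl_append]
    simp only [Fin.val_castSucc, ih, Fin.val_last, List.foldl_cons, List.foldl_nil, iter]

theorem cylProb_ofFn (ω : ℕ → Bool) (n : ℕ) (x : ℝ) :
    cylProb x₀ y₀ p₀ p₁ x (List.ofFn fun i : Fin n => ω i) =
      ∏ k ∈ Finset.range n, prob p₀ p₁ (ω k) (iter x₀ y₀ ω k x) := by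
  induction n with
  | zero => rfl
  | succ n ih =>
    rw [List.ofFn_succ', List.concat_eq_append, cylProb_append_singleton, Finset.prod_range_succ]
    simp only [Fin.val_castSucc, ih, Fin.val_last, foldl_ofFn]

theorem cyl_ofFn (ω : ℕ → Bool) (n : ℕ) :
    cyl (List.ofFn fun i : Fin n => ω i) = {ω' | ∀ i < n, ω' i = ω i} := by
  ext ω'
  simp only [cyl, mem_ofPred_eq, List.get_ofFn]
  constructor
  · intro h i hi
    simpa using h ⟨i, by simpa using hi⟩
  · intro h j
    simpa using h j (by simpa using j.2)

theorem dependsOn_iter (n : ℕ) (x : ℝ) :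
    DependsOn (fun ω => iter x₀ y₀ ω n x) (Iio n) := by
  intro ω ω' h
  induction n with
  | zero => rfl
  | succ n ih =>
    have h1 := ih fun i hi => h i (lt_trans hi (Nat.lt_succ_self n))
    have h2 := h n (Nat.lt_succ_self n)
    simp only at h1
    simp only [iter, h1, h2]

theorem iter_mem {S : Set ℝ} (hS : ∀ b, MapsTo (fb x₀ y₀ b) S S) (ω : ℕ → Bool) (n : ℕ)
    (hx : x ∈ S) : iter x₀ y₀ ω n x ∈ S := by
  induction n with
  | zero => exact hx
  | succ n ih => exact hS _ ih

/-- Extension of a finite word to a sequence. -/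
def extend {n : ℕ} (v : Fin n → Bool) (i : ℕ) : Bool := if h : i < n then v ⟨i, h⟩ else false

theorem measurableSet_agree (n : ℕ) (v : ℕ → Bool) :
    MeasurableSet {ω : ℕ → Bool | ∀ i < n, ω i = v i} := by
  simp only [ofPred_forall]
  exact MeasurableSet.iInter fun i => MeasurableSet.iInter fun _ =>
    measurableSet_eq_fun (measurable_pi_apply i) measurable_const

theorem eq_sum_of_dependsOn {n : ℕ} {Φ : (ℕ → Bool) → ℝ} (hΦ : DependsOn Φ (Iio n)) :
    Φ = fun ω => ∑ v : Fin n → Bool,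
      {ω' : ℕ → Bool | ∀ i < n, ω' i = extend v i}.indicator (fun _ => Φ (extend v)) ω := by
  ext ω
  rw [Finset.sum_eq_single_of_mem (fun i : Fin n => ω i) (Finset.mem_univ _)]
  · rw [indicator_of_mem]
    · exact hΦ fun i hi => by simp [extend, mem_Iio.1 hi]
    · intro i hi
      simp [extend, hi]
  · intro v _ hv
    rw [indicator_of_notMem]
    intro h
    refine hv (funext fun i => ?_)
    have := h i i.2
    simpa [extend] using this.symm

theorem integrable_of_dependsOn {P : Measure (ℕ → Bool)} [IsFiniteMeasure P] {n : ℕ}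
    {Φ : (ℕ → Bool) → ℝ} (hΦ : DependsOn Φ (Iio n)) : Integrable Φ P := by
  rw [eq_sum_of_dependsOn hΦ]
  exact integrable_finsetSum _ fun v _ =>
    (integrable_const _).indicator (measurableSet_agree n _)

theorem setIntegral_of_dependsOn {P : Measure (ℕ → Bool)} [IsFiniteMeasure P] {n : ℕ}
    {Φ : (ℕ → Bool) → ℝ} (hΦ : DependsOn Φ (Iio n)) (A : Set (ℕ → Bool)) :
    ∫ ω in A, Φ ω ∂P = ∑ v : Fin n → Bool,
      P.real ({ω' : ℕ → Bool | ∀ i < n, ω' i = extend v i} ∩ A) * Φ (extend v) := by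
  conv_lhs => rw [eq_sum_of_dependsOn hΦ]
  rw [integral_finsetSum _ fun v _ =>
    (integrable_const _).indicator (measurableSet_agree n _)]
  refine Finset.sum_congr rfl fun v _ => ?_
  rw [integral_indicator_const _ (measurableSet_agree n _), smul_eq_mul,
    measureReal_restrict_apply (measurableSet_agree n _)]

variable (hPm : IsKernel x₀ y₀ p₀ p₁ Pm)
  (hsys : IsSystem (prob p₀ p₁) (fb x₀ y₀) (Ioo 0 1)) (hx : x ∈ Ioo (0 : ℝ) 1)

include hPm hx in
theorem isProbabilityMeasure_kernel : IsProbabilityMeasure (Pm x) := by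
  refine ⟨?_⟩
  have := hPm x hx []
  simpa [cyl, cylProb] using this

include hPm hsys hx in
theorem kernel_real_agree (n : ℕ) (v : ℕ → Bool) :
    (Pm x).real {ω | ∀ i < n, ω i = v i} =
      ∏ k ∈ Finset.range n, prob p₀ p₁ (v k) (iter x₀ y₀ v k x) := by
  rw [measureReal_def, ← cyl_ofFn, hPm x hx, cylProb_ofFn, ENNReal.toReal_ofReal]
  exact Finset.prod_nonneg fun k _ => hsys.nonneg _ _ (iter_mem hsys.mapsTo v k hx)

include hPm hsys hx in
theorem setIntegral_eq_integral_mul_prob {n : ℕ} {Φ : (ℕ → Bool) → ℝ}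
    (hΦ : DependsOn Φ (Iio n)) (b : Bool) :
    ∫ ω in {ω | ω n = b}, Φ ω ∂(Pm x) =
      ∫ ω, Φ ω * prob p₀ p₁ b (iter x₀ y₀ ω n x) ∂(Pm x) := by
  have := isProbabilityMeasure_kernel hPm hx
  have hΦ' : DependsOn (fun ω => Φ ω * prob p₀ p₁ b (iter x₀ y₀ ω n x)) (Iio n) := by
    intro ω ω' h
    have h1 := dependsOn_iter (x₀ := x₀) (y₀ := y₀) n x h
    simp only at h1
    simp only [hΦ h, h1]
  rw [← setIntegral_univ (f := fun ω => Φ ω * _), setIntegral_of_dependsOn hΦ,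
    setIntegral_of_dependsOn hΦ']
  refine Finset.sum_congr rfl fun v _ => ?_
  have hset : {ω' : ℕ → Bool | ∀ i < n, ω' i = extend v i} ∩ {ω | ω n = b} =
      {ω' | ∀ i < n + 1, ω' i = Function.update (extend v) n b i} := by
    ext ω
    simp only [mem_inter_iff, mem_ofPred_eq, Order.lt_add_one_iff]
    constructor
    · rintro ⟨h1, h2⟩ i hi
      rcases hi.lt_or_eq with h | rfl
      · rw [Function.update_of_ne h.ne, h1 i h]
      · rw [Function.update_self, h2]
    · intro h
      refine ⟨fun i hi => ?_, ?_⟩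
      · rw [h i hi.le, Function.update_of_ne hi.ne]
      · rw [h n le_rfl, Function.update_self]
  have hiter : ∀ k ≤ n, iter x₀ y₀ (Function.update (extend v) n b) k x =
      iter x₀ y₀ (extend v) k x := fun k hk =>
    dependsOn_iter k x fun i hi => Function.update_of_ne ((mem_Iio.1 hi).trans_le hk).ne _ _
  rw [hset, inter_univ, kernel_real_agree hPm hsys hx, kernel_real_agree hPm hsys hx,
    Finset.prod_range_succ, Function.update_self, hiter n le_rfl]
  rw [Finset.prod_congr rfl fun k hk => by
    rw [hiter k (Finset.mem_range.1 hk).le, Function.update_of_ne (Finset.mem_range.1 hk).ne]]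
  ring

include hPm hsys hx in
/-- The Markov property. -/
theorem integral_mul_iter_succ {n : ℕ} {Φ : (ℕ → Bool) → ℝ} (hΦ : DependsOn Φ (Iio n))
    (ψ : ℝ → ℝ) :
    ∫ ω, Φ ω * ψ (iter x₀ y₀ ω (n + 1) x) ∂(Pm x) =
      ∫ ω, Φ ω * avg (prob p₀ p₁) (fb x₀ y₀) ψ (iter x₀ y₀ ω n x) ∂(Pm x) := by
  have := isProbabilityMeasure_kernel hPm hx
  have hdep : ∀ b, DependsOn (fun ω => Φ ω * ψ (fb x₀ y₀ b (iter x₀ y₀ ω n x))) (Iio n) := by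
    intro b ω ω' h
    have h1 := dependsOn_iter (x₀ := x₀) (y₀ := y₀) n x h
    simp only at h1
    simp only [hΦ h, h1]
  have hmeas : ∀ b, MeasurableSet {ω : ℕ → Bool | ω n = b} := fun b =>
    measurableSet_eq_fun (measurable_pi_apply n) measurable_const
  have hsplit : ∀ ω, Φ ω * ψ (iter x₀ y₀ ω (n + 1) x) = ∑ b,
      {ω : ℕ → Bool | ω n = b}.indicator
        (fun ω => Φ ω * ψ (fb x₀ y₀ b (iter x₀ y₀ ω n x))) ω := by
    intro ω
    rw [Finset.sum_eq_single_of_mem (ω n) (Finset.mem_univ _)]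
    · have h1 : ω ∈ {ω' : ℕ → Bool | ω' n = ω n} := rfl
      rw [indicator_of_mem h1, iter]
    · exact fun b _ hb => indicator_of_notMem (fun h => hb h.symm) _
  simp_rw [hsplit]
  rw [integral_finsetSum _ fun b _ => (integrable_of_dependsOn (hdep b)).indicator (hmeas b)]
  simp_rw [integral_indicator (hmeas _),
    setIntegral_eq_integral_mul_prob hPm hsys hx (hdep _)]
  rw [← integral_finsetSum]
  · refine integral_congr_ae (ae_of_all _ fun ω => ?_)
    simp only [avg, Finset.mul_sum]
    exact Finset.sum_congr rfl fun b _ => by ring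
  · intro b _
    refine integrable_of_dependsOn (n := n) fun ω ω' h => ?_
    have h1 := dependsOn_iter (x₀ := x₀) (y₀ := y₀) n x h
    simp only at h1
    simp only [hΦ h, h1]

include hPm hsys hx in
/-- The averages of `ψ (X (k + 1))` and of its conditional expectation given `X k` are
asymptotically equal. -/
theorem ae_tendsto_average_increment {ψ : ℝ → ℝ} {C : ℝ}
    (hC : ∀ n, ∫ ω, ψ (iter x₀ y₀ ω n x) ^ 2 ∂(Pm x) ≤ C) :
    ∀ᵐ ω ∂(Pm x), Tendsto (fun n : ℕ => (∑ k ∈ Finset.range n,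
      (ψ (iter x₀ y₀ ω (k + 1) x) - avg (prob p₀ p₁) (fb x₀ y₀) ψ (iter x₀ y₀ ω k x))) / n)
      atTop (𝓝 0) := by
  have := isProbabilityMeasure_kernel hPm hx
  set U := avg (prob p₀ p₁) (fb x₀ y₀) with hU
  set d : ℕ → (ℕ → Bool) → ℝ := fun k ω =>
    ψ (iter x₀ y₀ ω (k + 1) x) - U ψ (iter x₀ y₀ ω k x) with hd
  have hdepI : ∀ {k m} (f : ℝ → ℝ), k ≤ m →
      DependsOn (fun ω => f (iter x₀ y₀ ω k x)) (Iio m) := by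
    intro k m f hkm ω ω' h
    have h1 := dependsOn_iter (x₀ := x₀) (y₀ := y₀) k x
      (fun i hi => h i ((mem_Iio.1 hi).trans_le hkm))
    simp only at h1
    simp only [h1]
  have hdep : ∀ {k m}, k < m → DependsOn (d k) (Iio m) := by
    intro k m hkm ω ω' h
    have h1 := hdepI ψ (Nat.succ_le_of_lt hkm) h
    have h2 := hdepI (U ψ) hkm.le h
    simp only at h1 h2
    simp only [hd, h1, h2]
  have hmul : ∀ {m} {f g : (ℕ → Bool) → ℝ}, DependsOn f (Iio m) → DependsOn g (Iio m) →
      DependsOn (fun ω => f ω * g ω) (Iio m) := fun hf hg ω ω' h => by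
    simp only [hf h, hg h]
  refine tendsto_average_of_orthogonal (d := d) (C := 2 * C + 2 * C)
    (fun i j => integrable_of_dependsOn (n := max i j + 1)
      (hmul (hdep (by omega)) (hdep (by omega)))) (fun i j hij => ?_) (fun i => ?_)
  · simp only [hd, mul_sub]
    rw [integral_sub, integral_mul_iter_succ hPm hsys hx (hdep hij), sub_self]
    · exact integrable_of_dependsOn (n := j + 1) (hmul (hdep (by omega)) (hdepI ψ le_rfl))
    · exact integrable_of_dependsOn (n := j) (hmul (hdep hij) (hdepI (U ψ) le_rfl))
  · have h1 := integral_mul_iter_succ (n := i) (Φ := fun _ => 1) hPm hsys hx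
      (fun _ _ _ => rfl) (fun z => ψ z ^ 2)
    simp only [one_mul] at h1
    have hi1 : Integrable (fun ω => 2 * ψ (iter x₀ y₀ ω (i + 1) x) ^ 2) (Pm x) :=
      integrable_of_dependsOn (hdepI (fun z => 2 * ψ z ^ 2) le_rfl)
    have hi2 : Integrable (fun ω => 2 * U (fun z => ψ z ^ 2) (iter x₀ y₀ ω i x)) (Pm x) :=
      integrable_of_dependsOn (hdepI (fun z => 2 * U (fun z => ψ z ^ 2) z) le_rfl)
    calc ∫ ω, d i ω * d i ω ∂(Pm x)
        ≤ ∫ ω, (2 * ψ (iter x₀ y₀ ω (i + 1) x) ^ 2 +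
            2 * U (fun z => ψ z ^ 2) (iter x₀ y₀ ω i x)) ∂(Pm x) := by
          refine integral_mono (integrable_of_dependsOn (n := i + 1)
            (hmul (hdep (by omega)) (hdep (by omega)))) (hi1.add hi2) fun ω => ?_
          have h2 := hsys.sq_avg_le ψ _ (iter_mem hsys.mapsTo ω i hx)
          simp only [hd]
          nlinarith [sq_nonneg (ψ (iter x₀ y₀ ω (i + 1) x) + U ψ (iter x₀ y₀ ω i x))]
      _ ≤ 2 * C + 2 * C := by
          rw [integral_add hi1 hi2, integral_const_mul, integral_const_mul, ← h1]
          have := hC (i + 1)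
          linarith

end Kernel

/-! ### The maps -/

section Maps

variable {x₀ y₀ : ℝ} (hA : A1 x₀ y₀)

include hA

theorem slope_pos : 0 < y₀ / x₀ := by
  obtain ⟨h1, h2, h3, h4⟩ := hA
  exact div_pos (by linarith) (by linarith)

theorem slope_lt_one : y₀ / x₀ < 1 := by
  obtain ⟨h1, h2, h3, h4⟩ := hA
  rw [div_lt_one (by linarith)]
  exact h4

theorem one_lt_slope : 1 < (1 - y₀) / (1 - x₀) := by
  obtain ⟨h1, h2, h3, h4⟩ := hA
  rw [one_lt_div (by linarith)]
  linarith

theorem one_lt_slope_mul_slope : 1 < y₀ / x₀ * ((1 - y₀) / (1 - x₀)) := by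
  obtain ⟨h1, h2, h3, h4⟩ := hA
  rw [div_mul_div_comm, one_lt_div (mul_pos (by linarith) (by linarith))]
  nlinarith

theorem slope_mul : y₀ / x₀ * x₀ = y₀ := by
  obtain ⟨h1, h2, h3, h4⟩ := hA
  exact div_mul_cancel₀ _ (by linarith)

theorem slope_mul_one_sub : (1 - y₀) / (1 - x₀) * (1 - x₀) = 1 - y₀ := by
  obtain ⟨h1, h2, h3, h4⟩ := hA
  exact div_mul_cancel₀ _ (by linarith)

omit hA in
theorem f0_of_le {x : ℝ} (hx : x ≤ x₀) : f0 x₀ y₀ x = y₀ / x₀ * x := if_pos hx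

theorem one_sub_f0_of_ge {x : ℝ} (hx : x₀ ≤ x) :
    1 - f0 x₀ y₀ x = (1 - y₀) / (1 - x₀) * (1 - x) := by
  rcases hx.lt_or_eq with h | rfl
  · rw [f0, if_neg h.not_ge]; ring
  · rw [f0_of_le le_rfl, slope_mul hA, slope_mul_one_sub hA]

omit hA in
theorem one_sub_f1_of_ge {x : ℝ} (hx : 1 - x₀ ≤ x) : 1 - f1 x₀ y₀ x = y₀ / x₀ * (1 - x) := by
  rw [f1, f0_of_le (by linarith)]; ring

theorem f1_of_le {x : ℝ} (hx : x ≤ 1 - x₀) : f1 x₀ y₀ x = (1 - y₀) / (1 - x₀) * x := by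
  rw [f1, one_sub_f0_of_ge hA (by linarith)]; ring

theorem f0_mono : Monotone (f0 x₀ y₀) := by
  have h0 := slope_pos hA
  have h1 := one_lt_slope hA
  have key1 : ∀ x y, x ≤ y → y ≤ x₀ → f0 x₀ y₀ x ≤ f0 x₀ y₀ y := fun x y hxy hy => by
    rw [f0_of_le (hxy.trans hy), f0_of_le hy]; gcongr
  have key2 : ∀ x y, x ≤ y → x₀ ≤ x → f0 x₀ y₀ x ≤ f0 x₀ y₀ y := fun x y hxy hx => by
    have e1 := one_sub_f0_of_ge hA hx
    have e2 := one_sub_f0_of_ge hA (hx.trans hxy)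
    nlinarith
  intro x y hxy
  rcases le_total y x₀ with hy | hy
  · exact key1 x y hxy hy
  · rcases le_total x x₀ with hx | hx
    · exact (key1 x x₀ hx le_rfl).trans (key2 x₀ y hy le_rfl)
    · exact key2 x y hxy hx

theorem f0_mem {x : ℝ} (hx : x ∈ Ioo (0 : ℝ) 1) : f0 x₀ y₀ x ∈ Ioo (0 : ℝ) 1 := by
  have h0 := slope_pos hA
  have h1 := one_lt_slope hA
  have h2 := slope_lt_one hA
  rcases le_total x x₀ with h | h
  · rw [f0_of_le h]
    exact ⟨mul_pos h0 hx.1, by nlinarith [hx.1, hx.2]⟩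
  · have e := one_sub_f0_of_ge hA h
    have : 0 < (1 - y₀) / (1 - x₀) * (1 - x) := mul_pos (by linarith) (by linarith [hx.2])
    have : (1 - y₀) / (1 - x₀) * (1 - x) ≤ (1 - y₀) / (1 - x₀) * (1 - x₀) := by gcongr
    rw [slope_mul_one_sub hA] at this
    obtain ⟨_, _, _, _⟩ := hA
    constructor <;> linarith

theorem fb_mem (b : Bool) : MapsTo (fb x₀ y₀ b) (Ioo (0 : ℝ) 1) (Ioo 0 1) := by
  intro x hx
  cases b
  · exact f0_mem hA hx
  · have := f0_mem hA (x := 1 - x) ⟨by linarith [hx.2], by linarith [hx.1]⟩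
    exact ⟨by simp only [fb, f1, if_true]; linarith [this.2],
      by simp only [fb, f1, if_true]; linarith [this.1]⟩

theorem fb_mono (b : Bool) : Monotone (fb x₀ y₀ b) := by
  cases b
  · exact f0_mono hA
  · intro x y hxy
    have := f0_mono hA (show 1 - y ≤ 1 - x by linarith)
    simp only [fb, f1, if_true]
    linarith

theorem continuous_fb (b : Bool) : Continuous (fb x₀ y₀ b) := by
  have h0 : Continuous (f0 x₀ y₀) := by
    refine Continuous.if_le (by fun_prop) (by fun_prop) continuous_id continuous_const ?_
    intro x hx
    have e1 := slope_mul hA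
    have e2 := slope_mul_one_sub hA
    subst hx
    linarith
  cases b
  · exact h0
  · exact continuous_const.sub (h0.comp (continuous_const.sub continuous_id))

theorem slope_mul_le_f0 (x : ℝ) : y₀ / x₀ * x ≤ f0 x₀ y₀ x := by
  rcases le_total x x₀ with h | h
  · rw [f0_of_le h]
  · have e := one_sub_f0_of_ge hA h
    have e1 := slope_mul hA
    have e2 := slope_mul_one_sub hA
    have := one_lt_slope hA
    have := slope_lt_one hA
    nlinarith

theorem le_f1 {x : ℝ} (hx : 0 ≤ x) (hx1 : x ≤ 1) : x ≤ f1 x₀ y₀ x := by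
  have := one_lt_slope hA
  have := slope_lt_one hA
  rcases le_total x (1 - x₀) with h | h
  · rw [f1_of_le hA h]
    nlinarith
  · have e := one_sub_f1_of_ge (y₀ := y₀) h
    nlinarith

end Maps

/-! ### A coordinate in which both maps are nonexpanding -/

/-- The coordinate `s` on `(0,1)` with `ds = dx / min x (1 - x)` and `s (1/2) = 0`. -/
noncomputable def coord (x : ℝ) : ℝ :=
  if x ≤ 1 / 2 then Real.log (2 * x) else -Real.log (2 * (1 - x))

theorem coord_of_le {x : ℝ} (hx : x ≤ 1 / 2) : coord x = Real.log (2 * x) := if_pos hx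

theorem coord_of_ge {x : ℝ} (hx : 1 / 2 ≤ x) : coord x = -Real.log (2 * (1 - x)) := by
  rcases hx.lt_or_eq with h | rfl
  · exact if_neg h.not_ge
  · norm_num [coord]

theorem coord_one_sub (x : ℝ) : coord (1 - x) = -coord x := by
  rcases le_total x (1 / 2) with h | h
  · rw [coord_of_le h, coord_of_ge (by linarith), sub_sub_cancel]
  · rw [coord_of_ge h, coord_of_le (by linarith), neg_neg]

theorem coord_sub_le {x y : ℝ} (hx : 0 < x) (hxy : x ≤ y) (hy : y < 1) :
    y - x ≤ coord y - coord x := by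
  have key : ∀ x y : ℝ, 0 < x → x ≤ y → y ≤ 1 / 2 → y - x ≤ coord y - coord x := by
    intro x y hx hxy hy
    rw [coord_of_le hy, coord_of_le (hxy.trans hy), ← Real.log_div (by linarith) (by linarith)]
    refine le_trans ?_ (Real.one_sub_inv_le_log_of_pos (by apply div_pos <;> linarith))
    have : 1 - (2 * y / (2 * x))⁻¹ = (y - x) / y := by
      have : 0 < y := by linarith
      field_simp
    rw [this, le_div_iff₀ (by linarith)]
    nlinarith
  have key' : ∀ x y : ℝ, 1 / 2 ≤ x → x ≤ y → y < 1 → y - x ≤ coord y - coord x := by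
    intro x y hx hxy hy
    have := key (1 - y) (1 - x) (by linarith) (by linarith) (by linarith)
    rw [coord_one_sub, coord_one_sub] at this
    linarith
  rcases le_total y (1 / 2) with h | h
  · exact key x y hx hxy h
  · rcases le_total (1 / 2) x with h' | h'
    · exact key' x y h' hxy hy
    · have := key x (1 / 2) hx h' le_rfl
      have := key' (1 / 2) y le_rfl h hy
      linarith

theorem coord_sub_le_div {c x y : ℝ} (hc : 0 < c) (hx : c ≤ x) (hxy : x ≤ y) (hy : y ≤ 1 - c) :
    coord y - coord x ≤ (y - x) / c := by
  have key : ∀ x y : ℝ, c ≤ x → x ≤ y → y ≤ 1 / 2 → coord y - coord x ≤ (y - x) / c := by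
    intro x y hx hxy hy
    have hx0 : 0 < x := hc.trans_le hx
    rw [coord_of_le hy, coord_of_le (hxy.trans hy), ← Real.log_div (by linarith) (by linarith)]
    refine (Real.log_le_sub_one_of_pos (by apply div_pos <;> linarith)).trans ?_
    have : 2 * y / (2 * x) - 1 = (y - x) / x := by field_simp
    rw [this]
    have : 0 ≤ y - x := by linarith
    gcongr
  have key' : ∀ x y : ℝ, 1 / 2 ≤ x → x ≤ y → y ≤ 1 - c → coord y - coord x ≤ (y - x) / c := by
    intro x y hx hxy hy
    have := key (1 - y) (1 - x) (by linarith) (by linarith) (by linarith)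
    rw [coord_one_sub, coord_one_sub] at this
    have e : 1 - x - (1 - y) = y - x := by ring
    rw [e] at this
    linarith
  rcases le_total y (1 / 2) with h | h
  · exact key x y hx hxy h
  · rcases le_total (1 / 2) x with h' | h'
    · exact key' x y h' hxy hy
    · have h1 := key x (1 / 2) hx h' le_rfl
      have h2 := key' (1 / 2) y le_rfl h hy
      calc coord y - coord x = (coord y - coord (1 / 2)) + (coord (1 / 2) - coord x) := by ring
        _ ≤ (y - 1 / 2) / c + (1 / 2 - x) / c := add_le_add h2 h1
        _ = (y - x) / c := by ring

theorem coord_monotoneOn : MonotoneOn coord (Ioo 0 1) := fun x hx y hy hxy => by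
  have := coord_sub_le hx.1 hxy hy.2
  linarith

theorem abs_sub_le_coord {x y : ℝ} (hx : x ∈ Ioo (0 : ℝ) 1) (hy : y ∈ Ioo (0 : ℝ) 1) :
    |x - y| ≤ |coord x - coord y| := by
  wlog hxy : x ≤ y generalizing x y
  · rw [abs_sub_comm, abs_sub_comm (coord x)]
    exact this hy hx (le_of_not_ge hxy)
  have := coord_sub_le hx.1 hxy hy.2
  rw [abs_sub_comm, abs_sub_comm (coord x), abs_of_nonneg (by linarith)]
  exact this.trans (le_abs_self _)

theorem abs_coord_sub_le {c x y : ℝ} (hc : 0 < c) (hx : x ∈ Icc c (1 - c))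
    (hy : y ∈ Icc c (1 - c)) : |coord x - coord y| ≤ |x - y| / c := by
  wlog hxy : x ≤ y generalizing x y
  · rw [abs_sub_comm, abs_sub_comm x]
    exact this hy hx (le_of_not_ge hxy)
  have h1 := coord_sub_le_div hc hx.1 hxy hy.2
  have h2 := coord_sub_le (hc.trans_le hx.1) hxy (by linarith [hy.2])
  rw [abs_sub_comm, abs_sub_comm x, abs_of_nonneg (by linarith), abs_of_nonneg (by linarith)]
  exact h1

section Nonexpanding

variable {x₀ y₀ : ℝ} (hA : A1 x₀ y₀)

include hA

theorem coord_sub_coord_f0_monotoneOn :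
    MonotoneOn (fun x => coord x - coord (f0 x₀ y₀ x)) (Ioo 0 1) := by
  have ha := slope_pos hA
  have ha1 := slope_lt_one hA
  have hb := one_lt_slope hA
  have hmul := slope_mul hA
  have hmul' := slope_mul_one_sub hA
  obtain ⟨h1, h2, h3, h4⟩ := id hA
  set a := y₀ / x₀ with had
  set b := (1 - y₀) / (1 - x₀)
  set m := 1 / (2 * a) with hmd
  have hm1 : 1 / 2 ≤ m := by
    rw [hmd, div_le_div_iff₀ (by norm_num) (by positivity)]; linarith
  have ham : a * m = 1 / 2 := by rw [hmd]; field_simp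
  have hm2 : m ≤ x₀ := by
    by_contra! h
    have : a * x₀ < a * m := by gcongr
    linarith
  have p1 : MonotoneOn (fun x => coord x - coord (f0 x₀ y₀ x)) (Ioc 0 (1 / 2)) := by
    have : ∀ x ∈ Ioc (0 : ℝ) (1 / 2), coord x - coord (f0 x₀ y₀ x) = -Real.log a := by
      intro x hx
      have hx0 : 0 < x := hx.1
      rw [f0_of_le (by linarith [hx.2]), coord_of_le hx.2,
        coord_of_le (by nlinarith [hx.1, hx.2]), show 2 * (a * x) = a * (2 * x) by ring,
        Real.log_mul ha.ne' (by positivity)]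
      ring
    intro x hx y hy _
    simp only [this x hx, this y hy, le_refl]
  have p2 : MonotoneOn (fun x => coord x - coord (f0 x₀ y₀ x)) (Icc (1 / 2) m) := by
    have : ∀ x ∈ Icc (1 / 2 : ℝ) m, coord x - coord (f0 x₀ y₀ x) =
        -Real.log (2 * (1 - x) * (2 * (a * x))) := by
      intro x hx
      have hx0 : 0 < x := by linarith [hx.1]
      have hx1 : 0 < 1 - x := by linarith [hx.2]
      rw [f0_of_le (by linarith [hx.2]), coord_of_ge hx.1,
        coord_of_le (by nlinarith [hx.1, hx.2]), Real.log_mul (x := 2 * (1 - x)) (y := 2 * (a * x)) (by positivity) (by positivity)]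
      ring
    intro x hx y hy hxy
    have hy0 : 0 < y := by linarith [hy.1]
    have hy1 : 0 < 1 - y := by linarith [hy.2]
    simp only [this x hx, this y hy]
    refine neg_le_neg (Real.log_le_log (by positivity) ?_)
    have : (1 - y) * y ≤ (1 - x) * x := by nlinarith [hx.1, hy.1]
    nlinarith
  have p3 : MonotoneOn (fun x => coord x - coord (f0 x₀ y₀ x)) (Icc m x₀) := by
    intro x hx y hy hxy
    have hx1 : 0 < 1 - x := by linarith [hx.2]
    have hy1 : 0 < 1 - y := by linarith [hy.2]
    have hax : 0 < 1 - a * x := by nlinarith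
    have hay : 0 < 1 - a * y := by nlinarith
    have hx2 : 1 / 2 ≤ a * x := by rw [← ham]; gcongr; exact hx.1
    have hy2 : 1 / 2 ≤ a * y := by rw [← ham]; gcongr; exact hy.1
    simp only [f0_of_le hx.2, f0_of_le hy.2]
    rw [coord_of_ge (hm1.trans hx.1), coord_of_ge (hm1.trans hy.1), coord_of_ge hx2,
      coord_of_ge hy2, sub_neg_eq_add, sub_neg_eq_add]
    have := Real.log_le_log (x := 2 * (1 - a * x) * (2 * (1 - y)))
      (y := 2 * (1 - a * y) * (2 * (1 - x))) (by positivity) (by nlinarith)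
    rw [Real.log_mul (x := 2 * (1 - a * x)) (y := 2 * (1 - y)) (by positivity) (by positivity),
      Real.log_mul (x := 2 * (1 - a * y)) (y := 2 * (1 - x)) (by positivity) (by positivity)]
      at this
    linarith
  have p4 : MonotoneOn (fun x => coord x - coord (f0 x₀ y₀ x)) (Ico x₀ 1) := by
    have : ∀ x ∈ Ico x₀ 1, coord x - coord (f0 x₀ y₀ x) = Real.log b := by
      intro x hx
      have e := one_sub_f0_of_ge hA hx.1
      have hx1 : 0 < 1 - x := by linarith [hx.2]
      have : b * (1 - x) ≤ b * (1 - x₀) := by gcongr; exact hx.1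
      rw [coord_of_ge (by linarith [hx.1]), coord_of_ge (by linarith), e,
        show 2 * (b * (1 - x)) = b * (2 * (1 - x)) by ring,
        Real.log_mul (x := b) (y := 2 * (1 - x)) (by positivity) (by positivity)]
      ring
    intro x hx y hy _
    simp only [this x hx, this y hy, le_refl]
  have q1 := p1.union_right p2 (isGreatest_Ioc (by norm_num)) (isLeast_Icc hm1)
  rw [Ioc_union_Icc_eq_Ioc (by norm_num) hm1] at q1
  have q2 := q1.union_right p3 (isGreatest_Ioc (by linarith)) (isLeast_Icc hm2)
  rw [Ioc_union_Icc_eq_Ioc (by linarith) hm2] at q2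
  have q3 := q2.union_right p4 (isGreatest_Ioc (by linarith)) (isLeast_Ico h2)
  rwa [Ioc_union_Ico_eq_Ioo (by linarith) h2] at q3

theorem abs_coord_f0_sub_le {x y : ℝ} (hx : x ∈ Ioo (0 : ℝ) 1) (hy : y ∈ Ioo (0 : ℝ) 1) :
    |coord (f0 x₀ y₀ x) - coord (f0 x₀ y₀ y)| ≤ |coord x - coord y| := by
  wlog hxy : x ≤ y generalizing x y
  · rw [abs_sub_comm, abs_sub_comm (coord x)]
    exact this hy hx (le_of_not_ge hxy)
  have h1 := coord_sub_coord_f0_monotoneOn hA hx hy hxy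
  have h2 := coord_monotoneOn (f0_mem hA hx) (f0_mem hA hy) (f0_mono hA hxy)
  have h3 := coord_monotoneOn hx hy hxy
  simp only at h1
  rw [abs_sub_comm, abs_sub_comm (coord x), abs_of_nonneg (by linarith),
    abs_of_nonneg (by linarith)]
  linarith

theorem abs_coord_fb_sub_le (b : Bool) {x y : ℝ} (hx : x ∈ Ioo (0 : ℝ) 1)
    (hy : y ∈ Ioo (0 : ℝ) 1) :
    |coord (fb x₀ y₀ b x) - coord (fb x₀ y₀ b y)| ≤ |coord x - coord y| := by
  cases b
  · exact abs_coord_f0_sub_le hA hx hy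
  · have := abs_coord_f0_sub_le hA (x := 1 - x) (y := 1 - y) ⟨by linarith [hx.2], by linarith [hx.1]⟩
      ⟨by linarith [hy.2], by linarith [hy.1]⟩
    simp only [fb, f1, if_true, coord_one_sub] at this ⊢
    rw [← abs_neg, ← abs_neg (coord x - coord y)]
    convert this using 2 <;> ring

/-- Iterates of `f₀ ∘ f₁` bring compact subsets of `(0,1)` to a fixed compact subset, contracting
them arbitrarily strongly. -/
theorem exists_iterate_contraction :
    ∃ c > 0, ∀ δ > 0, ∀ κ > 0, ∃ n, 0 < n ∧ ∀ x ∈ Icc δ (1 - δ), ∀ y ∈ Icc δ (1 - δ),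
      (fb x₀ y₀ false ∘ fb x₀ y₀ true)^[n] x ∈ Icc c (1 - c) ∧
      |coord ((fb x₀ y₀ false ∘ fb x₀ y₀ true)^[n] x) -
        coord ((fb x₀ y₀ false ∘ fb x₀ y₀ true)^[n] y)| ≤ κ * |coord x - coord y| := by
  have ha := slope_pos hA
  have ha1 := slope_lt_one hA
  have hb := one_lt_slope hA
  have hab := one_lt_slope_mul_slope hA
  have hmul := slope_mul hA
  have hmul' := slope_mul_one_sub hA
  obtain ⟨h1, h2, h3, h4⟩ := id hA
  set g := fb x₀ y₀ false ∘ fb x₀ y₀ true with hg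
  set a := y₀ / x₀ with had
  set b := (1 - y₀) / (1 - x₀)
  have hgx : ∀ x, g x = f0 x₀ y₀ (f1 x₀ y₀ x) := fun x => rfl
  have hgmono : Monotone g := (fb_mono hA false).comp (fb_mono hA true)
  have hgmem : MapsTo g (Ioo 0 1) (Ioo 0 1) := (fb_mem hA false).comp (fb_mem hA true)
  have hgexp : ∀ n, ∀ x ∈ Ioo (0 : ℝ) 1, ∀ y ∈ Ioo (0 : ℝ) 1,
      |coord (g^[n] x) - coord (g^[n] y)| ≤ |coord x - coord y| := by
    intro n
    induction n with
    | zero => intro x _ y _; exact le_rfl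
    | succ n ih =>
      intro x hx y hy
      rw [Function.iterate_succ_apply, Function.iterate_succ_apply]
      exact (ih _ (hgmem hx) _ (hgmem hy)).trans
        ((abs_coord_fb_sub_le hA false (fb_mem hA true hx) (fb_mem hA true hy)).trans
          (abs_coord_fb_sub_le hA true hx hy))
  set u := 1 - x₀ with hu
  set v := (1 - x₀) / a with hv
  have hu0 : 0 < u := by linarith
  have hv0 : 0 < v := by positivity
  have hav : a * v = 1 - x₀ := by rw [hv]; field_simp
  have hvy : v < 1 - y₀ := by
    rw [hv, div_lt_iff₀ ha]
    have : 1 * (1 - x₀) < a * b * (1 - x₀) := by gcongr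
    nlinarith
  have huv : u ≤ 1 - v := by linarith
  -- the map on the three intervals where it is affine
  have g_left : ∀ x, x ≤ u → g x = a * b * x := by
    intro x hx
    have : b * x ≤ b * u := by gcongr
    rw [hgx, f1_of_le hA hx, f0_of_le (by linarith)]
    ring
  have g_mid : ∀ x, u ≤ x → x ≤ 1 - v → g x = a * (1 - a * (1 - x)) := by
    intro x hx hx'
    have e := one_sub_f1_of_ge (y₀ := y₀) hx
    have : a * v ≤ a * (1 - x) := by gcongr; linarith
    rw [hgx, show f1 x₀ y₀ x = 1 - a * (1 - x) by linarith, f0_of_le (by linarith)]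
  have g_right : ∀ x, 1 - v ≤ x → 1 - g x = a * b * (1 - x) := by
    intro x hx
    have e := one_sub_f1_of_ge (y₀ := y₀) (huv.trans hx)
    have : a * (1 - x) ≤ a * v := by gcongr; linarith
    rw [hgx, one_sub_f0_of_ge hA (by linarith), e]
    ring
  have gu : u ≤ g u := by rw [g_left u le_rfl]; nlinarith
  have gv : g (1 - v) ≤ 1 - v := by
    have := g_right (1 - v) le_rfl
    nlinarith
  have glow : ∀ n, ∀ x ∈ Ioo (0 : ℝ) 1, min ((a * b) ^ n * x) u ≤ g^[n] x := by
    intro n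
    induction n with
    | zero => intro x _; simp
    | succ n ih =>
      intro x hx
      rw [Function.iterate_succ_apply']
      rcases le_total (g^[n] x) u with h | h
      · rw [g_left _ h]
        rcases min_le_iff.1 (ih x hx) with h' | h'
        · refine (min_le_left _ _).trans ?_
          rw [pow_succ', mul_assoc]
          gcongr
        · exact (min_le_right _ _).trans (by nlinarith)
      · exact (min_le_right _ _).trans (gu.trans (hgmono h))
  have ghigh : ∀ n, ∀ x ∈ Ioo (0 : ℝ) 1, min ((a * b) ^ n * (1 - x)) v ≤ 1 - g^[n] x := by
    intro n
    induction n with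
    | zero => intro x _; simp
    | succ n ih =>
      intro x hx
      rw [Function.iterate_succ_apply']
      rcases le_total (1 - g^[n] x) v with h | h
      · rw [g_right _ (by linarith)]
        rcases min_le_iff.1 (ih x hx) with h' | h'
        · refine (min_le_left _ _).trans ?_
          rw [pow_succ', mul_assoc]
          gcongr
        · exact (min_le_right _ _).trans (by nlinarith)
      · have := hgmono (show g^[n] x ≤ 1 - v by linarith)
        exact (min_le_right _ _).trans (by linarith)
  have hM : MapsTo g (Icc u (1 - v)) (Icc u (1 - v)) := fun x hx =>
    ⟨gu.trans (hgmono hx.1), (hgmono hx.2).trans gv⟩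
  have hMc : ∀ n, ∀ x ∈ Icc u (1 - v), ∀ y ∈ Icc u (1 - v),
      |g^[n] x - g^[n] y| = (a * a) ^ n * |x - y| := by
    intro n
    induction n with
    | zero => intro x _ y _; simp
    | succ n ih =>
      intro x hx y hy
      rw [Function.iterate_succ_apply, Function.iterate_succ_apply, ih _ (hM hx) _ (hM hy),
        g_mid x hx.1 hx.2, g_mid y hy.1 hy.2,
        show a * (1 - a * (1 - x)) - a * (1 - a * (1 - y)) = a * a * (x - y) by ring, abs_mul,
        abs_of_pos (by positivity : 0 < a * a)]
      ring
  set c := min u v with hc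
  have hc0 : 0 < c := lt_min hu0 hv0
  have hMsub : Icc u (1 - v) ⊆ Icc c (1 - c) :=
    Icc_subset_Icc (min_le_left _ _) (by linarith [min_le_right u v])
  have hMIoo : Icc u (1 - v) ⊆ Ioo 0 1 := fun x hx => ⟨by linarith [hx.1], by linarith [hx.2]⟩
  refine ⟨c, hc0, fun δ hδ κ hκ => ?_⟩
  obtain ⟨n₁, hn₁⟩ := pow_unbounded_of_one_lt (max u v / δ) hab
  have hn₁' : max u v ≤ (a * b) ^ n₁ * δ := by
    rw [div_lt_iff₀ hδ] at hn₁
    exact hn₁.le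
  obtain ⟨n₂, hn₂⟩ := exists_pow_lt_of_lt_one (mul_pos hκ hc0)
    (show a * a < 1 by nlinarith)
  have hδIoo : Icc δ (1 - δ) ⊆ Ioo 0 1 := fun x hx => ⟨by linarith [hx.1], by linarith [hx.2]⟩
  have hin : ∀ x ∈ Icc δ (1 - δ), g^[n₁] x ∈ Icc u (1 - v) := by
    intro x hx
    have e1 := glow n₁ x (hδIoo hx)
    have e2 := ghigh n₁ x (hδIoo hx)
    have e3 : (a * b) ^ n₁ * δ ≤ (a * b) ^ n₁ * x := by gcongr; exact hx.1
    have e4 : (a * b) ^ n₁ * δ ≤ (a * b) ^ n₁ * (1 - x) := by gcongr; linarith [hx.2]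
    rw [min_eq_right ((le_max_left u v).trans (hn₁'.trans e3))] at e1
    rw [min_eq_right ((le_max_right u v).trans (hn₁'.trans e4))] at e2
    exact ⟨e1, by linarith⟩
  refine ⟨n₂ + 1 + n₁, by omega, fun x hx y hy => ?_⟩
  rw [Function.iterate_add_apply g (n₂ + 1) n₁ x, Function.iterate_add_apply g (n₂ + 1) n₁ y]
  have mx := hin x hx
  have my := hin y hy
  refine ⟨hMsub (hM.iterate _ mx), ?_⟩
  calc |coord (g^[n₂ + 1] (g^[n₁] x)) - coord (g^[n₂ + 1] (g^[n₁] y))|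
      ≤ |g^[n₂ + 1] (g^[n₁] x) - g^[n₂ + 1] (g^[n₁] y)| / c :=
        abs_coord_sub_le hc0 (hMsub (hM.iterate _ mx)) (hMsub (hM.iterate _ my))
    _ = (a * a) ^ (n₂ + 1) / c * |g^[n₁] x - g^[n₁] y| := by rw [hMc _ _ mx _ my]; ring
    _ ≤ κ * |coord x - coord y| := by
        have e1 : (a * a) ^ (n₂ + 1) ≤ κ * c := by
          refine le_trans ?_ hn₂.le
          exact pow_le_pow_of_le_one (by positivity) (by nlinarith) (by omega)
        rw [← div_le_iff₀ hc0] at e1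
        have e2 := (abs_sub_le_coord (hMIoo mx) (hMIoo my)).trans
          (hgexp n₁ x (hδIoo hx) y (hδIoo hy))
        gcongr

end Nonexpanding

/-! ### A Lyapunov function -/

section Drift

variable {x₀ y₀ : ℝ} (hA : A1 x₀ y₀)

include hA

/-- If the Lyapunov exponent at `0` is positive, then `x ↦ x ^ (-α)` satisfies a drift condition
for all small `α > 0`. -/
theorem eventually_exists_drift_rpow {w₀ w₁ : ℝ → ℝ} (h₀ : ContinuousOn w₀ (Icc 0 1))
    (h₁ : ContinuousOn w₁ (Icc 0 1))
    (hw : ∀ x ∈ Icc (0 : ℝ) 1, w₀ x + w₁ x = 1 ∧ 0 ≤ w₀ x ∧ 0 ≤ w₁ x)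
    (hΛ : 0 < w₀ 0 * Real.log (y₀ / x₀) + w₁ 0 * Real.log ((1 - y₀) / (1 - x₀))) :
    ∀ᶠ α in 𝓝[>] (0 : ℝ), ∃ q B : ℝ, 0 ≤ q ∧ q < 1 ∧ 0 ≤ B ∧ ∀ x ∈ Ioo (0 : ℝ) 1,
      w₀ x * f0 x₀ y₀ x ^ (-α) + w₁ x * f1 x₀ y₀ x ^ (-α) ≤ q * x ^ (-α) + B := by
  have ha := slope_pos hA
  have ha1 := slope_lt_one hA
  have hb := one_lt_slope hA
  have hf0 := slope_mul_le_f0 hA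
  have hf1 := @le_f1 x₀ y₀ hA
  have hf0' := @f0_of_le x₀ y₀
  have hf1' := @f1_of_le x₀ y₀ hA
  obtain ⟨hx1, hx2, -, -⟩ := hA
  set a := y₀ / x₀
  set b := (1 - y₀) / (1 - x₀)
  have hb0 : 0 < b := by linarith
  have h01 : (0 : ℝ) ∈ Icc (0 : ℝ) 1 := by simp
  have hder : HasDerivAt (fun α : ℝ => w₀ 0 * a ^ (-α) + w₁ 0 * b ^ (-α))
      (-(w₀ 0 * Real.log a + w₁ 0 * Real.log b)) 0 := by
    have e : ∀ c : ℝ, 0 < c → HasDerivAt (fun α : ℝ => c ^ (-α)) (-Real.log c) 0 := by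
      intro c hc
      have := (hasDerivAt_neg (0 : ℝ)).const_rpow hc
      simpa using this
    have := ((e a ha).const_mul (w₀ 0)).add ((e b hb0).const_mul (w₁ 0))
    rwa [mul_neg, mul_neg, ← neg_add] at this
  have hev : ∀ᶠ α in 𝓝[>] (0 : ℝ), w₀ 0 * a ^ (-α) + w₁ 0 * b ^ (-α) < 1 := by
    have h1 := (hasDerivAt_iff_tendsto_slope.1 hder).mono_left
      (nhdsWithin_mono (0 : ℝ) (fun y (hy : (0 : ℝ) < y) => hy.ne'))
    filter_upwards [h1.eventually_lt_const (neg_lt_zero.2 hΛ), self_mem_nhdsWithin] with α hα hα0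
    rw [slope_def_field, div_lt_iff₀ (by simpa using hα0)] at hα
    simp only [neg_zero, Real.rpow_zero, mul_one, zero_mul, (hw 0 h01).1] at hα
    linarith
  filter_upwards [hev, self_mem_nhdsWithin] with α hα hα0
  rw [mem_Ioi] at hα0
  set h := w₀ 0 * a ^ (-α) + w₁ 0 * b ^ (-α) with hh
  have hcont : ContinuousWithinAt (fun x => w₀ x * a ^ (-α) + w₁ x * b ^ (-α)) (Icc 0 1) 0 :=
    ((h₀ 0 h01).mul_const _).add ((h₁ 0 h01).mul_const _)
  have hnonneg : 0 ≤ h := by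
    have := (hw 0 h01).2.1
    have := (hw 0 h01).2.2
    positivity
  have hlt := hcont.eventually_lt_const (u := (1 + h) / 2) (by simp only; linarith)
  obtain ⟨δ', hδ', hδ⟩ := Metric.mem_nhdsWithin_iff.1 hlt
  set δ := min δ' (1 - x₀)
  have hδ0 : 0 < δ := lt_min hδ' (by linarith)
  refine ⟨(1 + h) / 2, (a * δ) ^ (-α), by positivity, by linarith, by positivity, ?_⟩
  intro x hx
  have hx01 : x ∈ Icc (0 : ℝ) 1 := ⟨hx.1.le, hx.2.le⟩
  have hxpos := hx.1
  obtain ⟨hsum, hp0, hp1⟩ := hw x hx01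
  rcases lt_or_ge x δ with hlt | hge
  · have hk := hδ ⟨by
      simp only [Metric.mem_ball, Real.dist_eq, sub_zero, abs_of_pos hxpos]
      exact hlt.trans_le (min_le_left _ _), hx01⟩
    have hlt' : x < 1 - x₀ := hlt.trans_le (min_le_right _ _)
    rw [mem_ofPred_eq] at hk
    rw [hf0' (by linarith), hf1' hlt'.le, Real.mul_rpow ha.le hxpos.le,
      Real.mul_rpow hb0.le hxpos.le]
    calc w₀ x * (a ^ (-α) * x ^ (-α)) + w₁ x * (b ^ (-α) * x ^ (-α))
        = (w₀ x * a ^ (-α) + w₁ x * b ^ (-α)) * x ^ (-α) := by ring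
      _ ≤ (1 + h) / 2 * x ^ (-α) := by gcongr
      _ ≤ _ := le_add_of_nonneg_right (by positivity)
  · have e0 : a * δ ≤ f0 x₀ y₀ x := (by gcongr : a * δ ≤ a * x).trans (hf0 x)
    have e1 : a * δ ≤ f1 x₀ y₀ x := le_trans (by nlinarith) (hf1 hx.1.le hx.2.le)
    have i0 := Real.rpow_le_rpow_of_nonpos (by positivity) e0 (neg_nonpos.2 hα0.le)
    have i1 := Real.rpow_le_rpow_of_nonpos (by positivity) e1 (neg_nonpos.2 hα0.le)
    calc w₀ x * f0 x₀ y₀ x ^ (-α) + w₁ x * f1 x₀ y₀ x ^ (-α)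
        ≤ w₀ x * (a * δ) ^ (-α) + w₁ x * (a * δ) ^ (-α) := by gcongr
      _ = (a * δ) ^ (-α) := by rw [← add_mul, hsum, one_mul]
      _ ≤ _ := le_add_of_nonneg_left (by positivity)

end Drift

/-- `V` is a Lyapunov function on `(0,1)` with compact sublevel sets, and so is its square. -/
structure IsLyapunov (x₀ y₀ : ℝ) (p₀ p₁ V : ℝ → ℝ) (q B : ℝ) : Prop where
  continuousOn : ContinuousOn V (Ioo 0 1)
  one_le : ∀ x ∈ Ioo (0 : ℝ) 1, 1 ≤ V x
  q_nonneg : 0 ≤ q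
  q_lt_one : q < 1
  B_nonneg : 0 ≤ B
  drift : ∀ x ∈ Ioo (0 : ℝ) 1, avg (prob p₀ p₁) (fb x₀ y₀) V x ≤ q * V x + B
  drift_sq : ∀ x ∈ Ioo (0 : ℝ) 1,
    avg (prob p₀ p₁) (fb x₀ y₀) (fun z => V z ^ 2) x ≤ q * V x ^ 2 + B
  exists_mem_Icc : ∀ R, ∃ δ > 0, ∀ x ∈ Ioo (0 : ℝ) 1, V x ≤ R → x ∈ Icc δ (1 - δ)

section Lyapunov

variable {x₀ y₀ : ℝ} {p₀ p₁ : ℝ → ℝ}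

theorem isSystem_prob_fb (hA : A1 x₀ y₀) (h3 : A3 p₀ p₁) :
    IsSystem (prob p₀ p₁) (fb x₀ y₀) (Ioo 0 1) where
  mapsTo := fb_mem hA
  nonneg b x hx := by
    obtain ⟨-, h0, -, h1, -⟩ := h3.2.2 x ⟨hx.1.le, hx.2.le⟩
    cases b
    · exact h0.le
    · exact h1.le
  sum_eq_one x hx := by
    have := (h3.2.2 x ⟨hx.1.le, hx.2.le⟩).1
    simp only [Fintype.sum_bool, prob, if_true]
    simpa [add_comm] using this

theorem exists_le_prob (h3 : A3 p₀ p₁) :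
    ∃ p > 0, p ≤ 1 ∧ ∀ b, ∀ x ∈ Ioo (0 : ℝ) 1, p ≤ prob p₀ p₁ b x := by
  obtain ⟨h0, h1, h⟩ := h3
  have hne : (Icc (0 : ℝ) 1).Nonempty := ⟨0, by simp⟩
  obtain ⟨u, hu, hu'⟩ := isCompact_Icc.exists_isMinOn hne h0
  obtain ⟨v, hv, hv'⟩ := isCompact_Icc.exists_isMinOn hne h1
  refine ⟨min (p₀ u) (p₁ v), lt_min (h u hu).2.1 (h v hv).2.2.2.1,
    (min_le_left _ _).trans (h u hu).2.2.1.le, ?_⟩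
  intro b x hx
  have hx' : x ∈ Icc (0 : ℝ) 1 := ⟨hx.1.le, hx.2.le⟩
  cases b
  · exact (min_le_left _ _).trans (hu' hx')
  · exact (min_le_right _ _).trans (hv' hx')

theorem exists_isLyapunov (hA : A1 x₀ y₀) (h3 : A3 p₀ p₁) (h4 : A4 x₀ y₀ p₀ p₁) :
    ∃ V q B, IsLyapunov x₀ y₀ p₀ p₁ V q B := by
  have hsys := isSystem_prob_fb hA h3
  have hflip : MapsTo (fun x : ℝ => 1 - x) (Icc 0 1) (Icc 0 1) := fun x hx =>
    ⟨by linarith [hx.2], by linarith [hx.1]⟩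
  have hflipc : ContinuousOn (fun x : ℝ => 1 - x) (Icc 0 1) := by fun_prop
  have hl := eventually_exists_drift_rpow hA h3.1 h3.2.1
    (fun x hx => ⟨(h3.2.2 x hx).1, (h3.2.2 x hx).2.1.le, (h3.2.2 x hx).2.2.2.1.le⟩) h4.1
  have hr := eventually_exists_drift_rpow hA (w₀ := fun x => p₁ (1 - x))
    (w₁ := fun x => p₀ (1 - x)) (h3.2.1.comp hflipc hflip) (h3.1.comp hflipc hflip)
    (fun x hx => ⟨by rw [add_comm]; exact (h3.2.2 _ (hflip hx)).1,
      (h3.2.2 _ (hflip hx)).2.2.2.1.le, (h3.2.2 _ (hflip hx)).2.1.le⟩)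
    (by simpa [add_comm] using h4.2)
  obtain ⟨α, ⟨⟨q₁, B₁, hq₁, hq₁', hB₁, hd₁⟩, ⟨q₂, B₂, hq₂, hq₂', hB₂, hd₂⟩⟩, hα⟩ :=
    ((hl.and hr).and self_mem_nhdsWithin).exists
  set W : ℝ → ℝ := fun x => x ^ (-α) + (1 - x) ^ (-α) with hW
  have hcl : ∀ x ∈ Ioo (0 : ℝ) 1, 1 ≤ x ^ (-α) := fun x hx =>
    Real.one_le_rpow_of_pos_of_le_one_of_nonpos hx.1 hx.2.le (neg_nonpos.2 hα.le)
  have hcr : ∀ x ∈ Ioo (0 : ℝ) 1, 1 ≤ (1 - x) ^ (-α) := fun x hx =>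
    hcl (1 - x) ⟨by linarith [hx.2], by linarith [hx.1]⟩
  have hW1 : ∀ x ∈ Ioo (0 : ℝ) 1, 1 ≤ W x := fun x hx => by
    have := hcl x hx
    have := hcr x hx
    simp only [hW]
    linarith
  have hWd : ∀ x ∈ Ioo (0 : ℝ) 1, avg (prob p₀ p₁) (fb x₀ y₀) W x ≤
      max q₁ q₂ * W x + (B₁ + B₂) := by
    intro x hx
    have e1 := hd₁ x hx
    have e2 := hd₂ (1 - x) ⟨by linarith [hx.2], by linarith [hx.1]⟩
    simp only [sub_sub_cancel] at e2
    have e3 : q₁ * x ^ (-α) ≤ max q₁ q₂ * x ^ (-α) :=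
      mul_le_mul_of_nonneg_right (le_max_left _ _) (zero_le_one.trans (hcl x hx))
    have e4 : q₂ * (1 - x) ^ (-α) ≤ max q₁ q₂ * (1 - x) ^ (-α) :=
      mul_le_mul_of_nonneg_right (le_max_right _ _) (zero_le_one.trans (hcr x hx))
    have e5 : f0 x₀ y₀ (1 - x) = 1 - f1 x₀ y₀ x := by rw [f1]; ring
    have e6 : f1 x₀ y₀ (1 - x) = 1 - f0 x₀ y₀ x := by rw [f1, sub_sub_cancel]
    rw [e5, e6] at e2
    simp only [avg, Fintype.sum_bool, prob, fb, hW, if_true]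
    simp only [Bool.false_eq_true, if_false]
    linarith
  set q := max q₁ q₂
  set B := B₁ + B₂
  have hq : 0 ≤ q := hq₁.trans (le_max_left _ _)
  have hq' : q < 1 := max_lt hq₁' hq₂'
  have hB : 0 ≤ B := add_nonneg hB₁ hB₂
  have hqs : q ≤ √q := Real.le_sqrt_of_sq_le (by nlinarith)
  have hVsq : ∀ x ∈ Ioo (0 : ℝ) 1, √(W x) ^ 2 = W x := fun x hx =>
    Real.sq_sqrt (zero_le_one.trans (hW1 x hx))
  have hWd' : ∀ x ∈ Ioo (0 : ℝ) 1, avg (prob p₀ p₁) (fb x₀ y₀) (fun z => √(W z) ^ 2) x ≤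
      q * √(W x) ^ 2 + B := by
    intro x hx
    rw [hVsq x hx]
    exact (hsys.avg_le (fun y hy => (hVsq y hy).le) x hx).trans (hWd x hx)
  refine ⟨fun x => √(W x), √q, max √B B, ?_, fun x hx => Real.one_le_sqrt.2 (hW1 x hx),
    by positivity, by rw [Real.sqrt_lt' one_pos]; simpa using hq', by positivity, ?_, ?_, ?_⟩
  · refine ContinuousOn.sqrt ((ContinuousOn.rpow_const continuousOn_id fun x hx =>
      Or.inl hx.1.ne').add (ContinuousOn.rpow_const (by fun_prop) fun x hx =>
        Or.inl (by linarith [hx.2])))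
  · intro x hx
    have h1 := (hsys.sq_avg_le (fun x => √(W x)) x hx).trans (hWd' x hx)
    refine ((le_abs_self _).trans (abs_le_of_sq_le_sq (b := √q * √(W x) + √B) (h1.trans ?_)
      (by positivity))).trans ?_
    · have e1 := Real.sq_sqrt hq
      have e2 := Real.sq_sqrt hB
      have : 0 ≤ √q * √(W x) * √B := by positivity
      nlinarith
    · gcongr
      exact le_max_left _ _
  · intro x hx
    refine (hWd' x hx).trans ?_
    have : 0 ≤ √(W x) ^ 2 := by positivity
    gcongr
    exact le_max_right _ _
  · intro R
    set R' := max R 1 with hR'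
    have hR1 : 1 ≤ R' := le_max_right _ _
    have key : ∀ x : ℝ, 0 < x → x ^ (-α) ≤ R' ^ 2 → (R' ^ 2) ^ (-α⁻¹) ≤ x := by
      intro x hx h
      have := Real.rpow_le_rpow_of_nonpos (by positivity) h (neg_nonpos.2 (inv_nonneg.2 hα.le))
      rwa [← Real.rpow_mul hx.le, neg_mul_neg, mul_inv_cancel₀ hα.ne', Real.rpow_one] at this
    refine ⟨(R' ^ 2) ^ (-α⁻¹), by positivity, fun x hx hxR => ?_⟩
    have hWR : W x ≤ R' ^ 2 := by
      rw [← hVsq x hx]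
      gcongr
      exact hxR.trans (le_max_left _ _)
    have := hcl x hx
    have := hcr x hx
    simp only [hW] at hWR
    have k1 := key x hx.1 (by linarith)
    have k2 := key (1 - x) (by linarith [hx.2]) (by linarith)
    exact ⟨k1, by linarith⟩

end Lyapunov

/-! ### Equicontinuity of the iterates of the averaging operator -/

section Synchronous

variable {x₀ y₀ : ℝ} {p₀ p₁ : ℝ → ℝ}

/-- The distance in the coordinate `coord`. -/
noncomputable def coordDist (ξ : ℝ × ℝ) : ℝ := |coord ξ.1 - coord ξ.2|

/-- The weights of the synchronous coupling, in which the first point chooses the map. -/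
def syncProb (p₀ p₁ : ℝ → ℝ) (b : Bool) (ξ : ℝ × ℝ) : ℝ := prob p₀ p₁ b ξ.1

/-- The maps of the synchronous coupling. -/
noncomputable def syncMap (x₀ y₀ : ℝ) (b : Bool) : ℝ × ℝ → ℝ × ℝ :=
  Prod.map (fb x₀ y₀ b) (fb x₀ y₀ b)

/-- The averaging operator of the synchronous coupling. -/
noncomputable def syncAvg (x₀ y₀ : ℝ) (p₀ p₁ : ℝ → ℝ) : (ℝ × ℝ → ℝ) → ℝ × ℝ → ℝ :=
  avg (syncProb p₀ p₁) (syncMap x₀ y₀)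

theorem coordDist_nonneg (ξ : ℝ × ℝ) : 0 ≤ coordDist ξ := abs_nonneg _

theorem coordDist_syncMap_le (hA : A1 x₀ y₀) (b : Bool) {ξ : ℝ × ℝ}
    (hξ : ξ ∈ Ioo (0 : ℝ) 1 ×ˢ Ioo (0 : ℝ) 1) :
    coordDist (syncMap x₀ y₀ b ξ) ≤ coordDist ξ :=
  abs_coord_fb_sub_le hA b hξ.1 hξ.2

theorem isSystem_sync (hA : A1 x₀ y₀) (h3 : A3 p₀ p₁) (r : ℝ) :
    IsSystem (syncProb p₀ p₁) (syncMap x₀ y₀)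
      {ξ | ξ ∈ Ioo (0 : ℝ) 1 ×ˢ Ioo (0 : ℝ) 1 ∧ coordDist ξ ≤ r} where
  mapsTo b _ hξ := ⟨⟨fb_mem hA b hξ.1.1, fb_mem hA b hξ.1.2⟩,
    (coordDist_syncMap_le hA b hξ.1).trans hξ.2⟩
  nonneg b ξ hξ := (isSystem_prob_fb hA h3).nonneg b ξ.1 hξ.1.1
  sum_eq_one ξ hξ := (isSystem_prob_fb hA h3).sum_eq_one ξ.1 hξ.1.1

theorem iterate_syncAvg_comp_fst (n : ℕ) (G : ℝ → ℝ) :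
    (syncAvg x₀ y₀ p₀ p₁)^[n] (G ∘ Prod.fst) =
      (avg (prob p₀ p₁) (fb x₀ y₀))^[n] G ∘ Prod.fst := by
  induction n generalizing G with
  | zero => rfl
  | succ n ih => exact ih (avg (prob p₀ p₁) (fb x₀ y₀) G)

theorem iterate_syncAvg_mul_le (hA : A1 x₀ y₀) (h3 : A3 p₀ p₁) {V : ℝ → ℝ}
    (hV : ∀ x ∈ Ioo (0 : ℝ) 1, 0 ≤ V x) (n : ℕ) {ξ : ℝ × ℝ}
    (hξ : ξ ∈ Ioo (0 : ℝ) 1 ×ˢ Ioo (0 : ℝ) 1) :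
    (syncAvg x₀ y₀ p₀ p₁)^[n] (fun η => coordDist η * V η.1) ξ ≤
      coordDist ξ * (avg (prob p₀ p₁) (fb x₀ y₀))^[n] V ξ.1 := by
  have h := (isSystem_sync hA h3 (coordDist ξ)).iterate_avg_le n
    (G := fun η => coordDist η * V η.1) (H := coordDist ξ • (V ∘ Prod.fst))
    (fun η hη => mul_le_mul_of_nonneg_right hη.2 (hV _ hη.1.1)) ξ ⟨hξ, le_rfl⟩
  rw [iterate_avg_smul] at h
  exact h.trans_eq (congrArg (coordDist ξ * ·)
    (congrFun (iterate_syncAvg_comp_fst (x₀ := x₀) (y₀ := y₀) (p₀ := p₀) (p₁ := p₁) n V) ξ))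

theorem iterate_syncAvg_coordDist_le (hA : A1 x₀ y₀) (h3 : A3 p₀ p₁) (n : ℕ) {ξ : ℝ × ℝ}
    (hξ : ξ ∈ Ioo (0 : ℝ) 1 ×ˢ Ioo (0 : ℝ) 1) :
    (syncAvg x₀ y₀ p₀ p₁)^[n] coordDist ξ ≤ coordDist ξ := by
  have h := (isSystem_sync hA h3 (coordDist ξ)).iterate_avg_le n
    (G := coordDist) (H := fun _ => coordDist ξ) (fun η hη => hη.2) ξ ⟨hξ, le_rfl⟩
  rwa [(isSystem_sync hA h3 (coordDist ξ)).iterate_avg_const n _ ξ ⟨hξ, le_rfl⟩] at h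

theorem IsLyapunov.iterate_avg_le {V : ℝ → ℝ} {q B : ℝ} (hV : IsLyapunov x₀ y₀ p₀ p₁ V q B)
    (hA : A1 x₀ y₀) (h3 : A3 p₀ p₁) (n : ℕ) {x : ℝ} (hx : x ∈ Ioo (0 : ℝ) 1) :
    (avg (prob p₀ p₁) (fb x₀ y₀))^[n] V x ≤ q ^ n * V x + B / (1 - q) :=
  (isSystem_prob_fb hA h3).iterate_avg_le_of_drift hV.q_nonneg hV.q_lt_one hV.B_nonneg hV.drift n
    x hx

/-- Nearby points approach each other exponentially fast on average. -/
theorem exists_syncAvg_decay (hA : A1 x₀ y₀) (h3 : A3 p₀ p₁) {V : ℝ → ℝ} {q B : ℝ}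
    (hV : IsLyapunov x₀ y₀ p₀ p₁ V q B) :
    ∃ r > 0, ∃ θ l C : ℝ, 0 < θ ∧ 0 < l ∧ l < 1 ∧ 0 ≤ C ∧
      ∀ ξ ∈ Ioo (0 : ℝ) 1 ×ˢ Ioo (0 : ℝ) 1, coordDist ξ ≤ r → ∀ k,
        (syncAvg x₀ y₀ p₀ p₁)^[k] (fun η => coordDist η * (1 + θ * V η.1)) ξ ≤
          C * l ^ k * (coordDist ξ * (1 + θ * V ξ.1)) := by
  have hq0 := hV.q_nonneg
  have hq1 := hV.q_lt_one
  have hV0 : ∀ x ∈ Ioo (0 : ℝ) 1, 0 ≤ V x := fun x hx => zero_le_one.trans (hV.one_le x hx)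
  obtain ⟨p, hp0, hp1, hp⟩ := exists_le_prob h3
  obtain ⟨_, _, hc⟩ := exists_iterate_contraction hA
  set B' := B / (1 - q) with hB'
  have hBnn : 0 ≤ B' := div_nonneg hV.B_nonneg (by linarith)
  set R := max 1 (2 * B' / (1 - q)) with hR
  have hRB : 2 * B' ≤ (1 - q) * R := by
    have : 2 * B' / (1 - q) ≤ R := le_max_right _ _
    rw [div_le_iff₀ (by linarith)] at this
    linarith
  obtain ⟨δ, hδ, hδV⟩ := hV.exists_mem_Icc R
  obtain ⟨n, hn, hcon⟩ := hc (δ / 2) (by linarith) (1 / 2) (by norm_num)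
  set κ := (p ^ 2) ^ n * (1 / 2)
  have hκ : 0 < κ := by positivity
  obtain ⟨θ, hθ, r, hr0, hr1, hw⟩ :=
    exists_weight_contraction hq0 hq1 hBnn hκ (le_max_left _ _) hRB
  set T := syncAvg x₀ y₀ p₀ p₁ with hT
  set D : ℝ × ℝ → ℝ := fun η => coordDist η * (1 + θ * V η.1) with hD
  have hDeq : D = coordDist + θ • fun η => coordDist η * V η.1 := by
    ext η
    simp only [hD, Pi.add_apply, Pi.smul_apply, smul_eq_mul]
    ring
  have hDn : ∀ k, ∀ ξ ∈ Ioo (0 : ℝ) 1 ×ˢ Ioo (0 : ℝ) 1, ∀ u v : ℝ,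
      T^[k] coordDist ξ ≤ coordDist ξ * u →
      (avg (prob p₀ p₁) (fb x₀ y₀))^[k] V ξ.1 ≤ v → T^[k] D ξ ≤ coordDist ξ * (u + θ * v) := by
    intro k ξ hξ u v hu hv
    have h1 := iterate_syncAvg_mul_le hA h3 hV0 k hξ
    have h2 := mul_le_mul_of_nonneg_left hv (coordDist_nonneg ξ)
    have h3 := mul_le_mul_of_nonneg_left (h1.trans h2) hθ.le
    rw [hDeq, hT, syncAvg, iterate_avg_add, iterate_avg_smul]
    simp only [Pi.add_apply, Pi.smul_apply, smul_eq_mul]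
    rw [hT, syncAvg] at hu
    rw [syncAvg] at h3
    linarith
  have hloss : ∀ ξ ∈ Ioo (0 : ℝ) 1 ×ˢ Ioo (0 : ℝ) 1, coordDist ξ ≤ δ / 2 → V ξ.1 ≤ R →
      T^[2 * n] coordDist ξ ≤ coordDist ξ * (1 - κ) := by
    intro ξ hξ hξr hξR
    have m1 := hδV _ hξ.1 hξR
    have m2 := abs_le.1 ((abs_sub_le_coord hξ.1 hξ.2).trans hξr)
    have hc' := (hcon ξ.1 ⟨by linarith [m1.1], by linarith [m1.2]⟩ ξ.2
      ⟨by linarith [m1.1], by linarith [m1.2]⟩).2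
    have hs := isSystem_sync hA h3 (coordDist ξ)
    have h := hs.le_iterate_avg hp0.le (fun b η hη => hp b η.1 hη.1.1) true false n
      (H := (fun _ => coordDist ξ) - coordDist)
      (fun η hη => sub_nonneg.2 hη.2) ξ ⟨hξ, le_rfl⟩
    rw [iterate_avg_sub, Pi.sub_apply, Pi.sub_apply, hs.iterate_avg_const _ _ ξ ⟨hξ, le_rfl⟩] at h
    have e : (syncMap x₀ y₀ false ∘ syncMap x₀ y₀ true)^[n] ξ =
        ((fb x₀ y₀ false ∘ fb x₀ y₀ true)^[n] ξ.1, (fb x₀ y₀ false ∘ fb x₀ y₀ true)^[n] ξ.2) := by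
      rw [syncMap, syncMap, Prod.map_comp_map, Prod.map_iterate, Prod.map_apply']
    rw [e] at h
    have : (p ^ 2) ^ n * (coordDist ξ * (1 / 2)) ≤ (p ^ 2) ^ n * (coordDist ξ - coordDist
        ((fb x₀ y₀ false ∘ fb x₀ y₀ true)^[n] ξ.1, (fb x₀ y₀ false ∘ fb x₀ y₀ true)^[n] ξ.2)) := by
      gcongr
      simp only [coordDist] at hc' ⊢
      linarith
    rw [hT, syncAvg]
    simp only [κ]
    linarith
  obtain ⟨l, hl0, hl1, hl⟩ := exists_geometric_bound (m := 2 * n) (by omega) hr0 hr1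
    (show 0 ≤ 1 + θ * B' by positivity)
  refine ⟨δ / 2, by linarith, θ, l, (1 + θ * B') / r, hθ, hl0, hl1, by positivity,
    fun ξ hξ hξr => hl (fun k => T^[k] D ξ) ?_ ?_ ?_⟩
  · have := hV0 _ hξ.1
    exact mul_nonneg (coordDist_nonneg _) (by positivity)
  · intro k
    have hs := isSystem_sync hA h3 (δ / 2)
    have h := hs.iterate_avg_le k (G := T^[2 * n] D) (H := r • D) ?_ ξ ⟨hξ, hξr⟩
    · rw [iterate_avg_smul] at h
      simp only [Function.iterate_add_apply]
      exact h
    · rintro η ⟨hη, hηr⟩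
      have hVη := hV0 _ hη.1
      refine (hDn (2 * n) η hη (if V η.1 ≤ R then 1 - κ else 1) (q * V η.1 + B') ?_ ?_).trans ?_
      · split_ifs with h
        · exact hloss η hη hηr h
        · rw [mul_one]
          exact iterate_syncAvg_coordDist_le hA h3 _ hη
      · refine (hV.iterate_avg_le hA h3 (2 * n) hη.1).trans ?_
        have : q ^ (2 * n) ≤ q := pow_le_of_le_one hq0 hq1.le (by omega)
        gcongr
      · have := hw (V η.1) (if V η.1 ≤ R then 1 - κ else 1) (q * V η.1 + B') hVη
          (by split_ifs <;> linarith) le_rfl (fun h => by rw [if_pos h])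
        calc coordDist η * _ ≤ coordDist η * (r * (1 + θ * V η.1)) := by
              gcongr
              exact coordDist_nonneg _
          _ = (r • D) η := by simp only [hD, Pi.smul_apply, smul_eq_mul]; ring
  · intro k
    have hVξ := hV0 _ hξ.1
    refine (hDn k ξ hξ 1 (V ξ.1 + B') ?_ ?_).trans ?_
    · rw [mul_one]
      exact iterate_syncAvg_coordDist_le hA h3 _ hξ
    · refine (hV.iterate_avg_le hA h3 k hξ.1).trans ?_
      have : q ^ k ≤ 1 := pow_le_one₀ hq0 hq1.le
      have : q ^ k * V ξ.1 ≤ 1 * V ξ.1 := by gcongr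
      linarith
    · simp only [Function.iterate_zero, id_eq, hD]
      have h0 := coordDist_nonneg ξ
      have : 0 ≤ coordDist ξ * (θ * B' * (θ * V ξ.1)) := by positivity
      linarith

/-- The total discrepancy of the probabilities along the synchronous coupling is small if the two
points are close. -/
theorem exists_sum_syncAvg_le (hA : A1 x₀ y₀) (h2 : A2 p₀ p₁) (h3 : A3 p₀ p₁) {V : ℝ → ℝ}
    {q B : ℝ} (hV : IsLyapunov x₀ y₀ p₀ p₁ V q B) :
    ∃ θ > 0, ∀ ε > 0, ∃ r > 0, ∀ ξ ∈ Ioo (0 : ℝ) 1 ×ˢ Ioo (0 : ℝ) 1,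
      coordDist ξ * (1 + θ * V ξ.1) ≤ r → ∀ n, ∑ k ∈ Finset.range n, (syncAvg x₀ y₀ p₀ p₁)^[k]
        (fun η => ∑ b, |prob p₀ p₁ b η.1 - prob p₀ p₁ b η.2|) ξ ≤ ε := by
  obtain ⟨r₀, hr₀, θ, l, C, hθ, hl0, hl1, hC, hdecay⟩ := exists_syncAvg_decay hA h3 hV
  obtain ⟨β, hβ, hβs⟩ := h2
  have hV0 : ∀ x ∈ Ioo (0 : ℝ) 1, 0 ≤ V x := fun x hx => zero_le_one.trans (hV.one_le x hx)
  set D : ℝ × ℝ → ℝ := fun η => coordDist η * (1 + θ * V η.1) with hD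
  set b : ℝ × ℝ → ℝ := fun η => ∑ b, |prob p₀ p₁ b η.1 - prob p₀ p₁ b η.2| with hb
  set T := syncAvg x₀ y₀ p₀ p₁ with hT
  have hβ0 : ∀ t, 0 ≤ t → 0 ≤ β t := fun t ht => by
    simpa using (hβ t 0 (by simp) 0 (by simp) (by simpa using ht)).1
  have hDρ : ∀ ξ ∈ Ioo (0 : ℝ) 1 ×ˢ Ioo (0 : ℝ) 1, coordDist ξ ≤ D ξ := fun ξ hξ => by
    have := hV0 _ hξ.1
    exact le_mul_of_one_le_right (coordDist_nonneg _) (by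
      have : 0 ≤ θ * V ξ.1 := by positivity
      linarith)
  have hbD : ∀ ξ ∈ Ioo (0 : ℝ) 1 ×ˢ Ioo (0 : ℝ) 1, ∀ u > 0,
      b ξ ≤ 2 * β u + 2 / u * D ξ := by
    intro ξ hξ u hu
    have hx : ξ.1 ∈ Icc (0 : ℝ) 1 := Ioo_subset_Icc_self hξ.1
    have hy : ξ.2 ∈ Icc (0 : ℝ) 1 := Ioo_subset_Icc_self hξ.2
    have hD0 : 0 ≤ D ξ := (coordDist_nonneg _).trans (hDρ ξ hξ)
    simp only [hb, Fintype.sum_bool, prob, if_true, Bool.false_eq_true, if_false]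
    rcases le_or_gt |ξ.1 - ξ.2| u with h | h
    · obtain ⟨e1, e2⟩ := hβ u _ hx _ hy h
      have : 0 ≤ 2 / u * D ξ := by positivity
      linarith
    · have e1 := h.le.trans ((abs_sub_le_coord hξ.1 hξ.2).trans (hDρ ξ hξ))
      have e2 : 2 ≤ 2 / u * D ξ := by
        rw [div_mul_eq_mul_div, le_div_iff₀ hu]
        linarith
      obtain ⟨-, a1, a2, a3, a4⟩ := h3.2.2 _ hx
      obtain ⟨-, b1, b2, b3, b4⟩ := h3.2.2 _ hy
      have e3 : |p₀ ξ.1 - p₀ ξ.2| ≤ 1 := abs_le.2 ⟨by linarith, by linarith⟩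
      have e4 : |p₁ ξ.1 - p₁ ξ.2| ≤ 1 := abs_le.2 ⟨by linarith, by linarith⟩
      have := hβ0 u hu.le
      linarith
  set τ := √l with hτ
  have hτ0 : 0 < τ := Real.sqrt_pos.2 hl0
  have hτ1 : τ < 1 := by rw [hτ, Real.sqrt_lt' one_pos]; simpa using hl1
  have hτl : τ * τ = l := Real.mul_self_sqrt hl0.le
  have hs : Summable fun n : ℕ => β (τ ^ n) := by simpa using hβs 1 zero_le_one τ hτ0 hτ1
  refine ⟨θ, hθ, fun ε hε => ?_⟩
  obtain ⟨j, hj⟩ := ((tendsto_sum_nat_add fun n => β (τ ^ n)).eventually_lt_const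
    (show 0 < ε / 4 by linarith)).exists
  have hτ1' : 0 < 1 - τ := by linarith
  set K := 2 * C / (τ ^ j * (1 - τ)) with hK
  have hK0 : 0 ≤ K := by positivity
  refine ⟨min r₀ (ε / (2 * (K + 1))), lt_min hr₀ (by positivity), fun ξ hξ hξr n => ?_⟩
  have hDξ : D ξ ≤ ε / (2 * (K + 1)) := hξr.trans (min_le_right _ _)
  have hD0 : 0 ≤ D ξ := (coordDist_nonneg _).trans (hDρ ξ hξ)
  have hsys := isSystem_sync hA h3 (coordDist ξ)
  have hterm : ∀ k, T^[k] b ξ ≤ 2 * β (τ ^ (k + j)) + 2 * C / τ ^ j * D ξ * τ ^ k := by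
    intro k
    have h1 := hsys.iterate_avg_le k (G := b)
      (H := (fun _ => 2 * β (τ ^ (k + j))) + (2 / τ ^ (k + j)) • D)
      (fun η hη => hbD η hη.1 _ (by positivity)) ξ ⟨hξ, le_rfl⟩
    rw [iterate_avg_add, iterate_avg_smul, Pi.add_apply, hsys.iterate_avg_const k _ ξ ⟨hξ, le_rfl⟩,
      Pi.smul_apply, smul_eq_mul] at h1
    have h2 := hdecay ξ hξ ((hDρ ξ hξ).trans (hξr.trans (min_le_left _ _))) k
    have h4 : 2 / τ ^ (k + j) * (avg (syncProb p₀ p₁) (syncMap x₀ y₀))^[k] D ξ ≤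
        2 / τ ^ (k + j) * (C * l ^ k * D ξ) := by
      gcongr
      exact h2
    have h5 : 2 / τ ^ (k + j) * (C * l ^ k * D ξ) = 2 * C / τ ^ j * D ξ * τ ^ k := by
      rw [← hτl, mul_pow, pow_add]
      field_simp
    rw [hT, syncAvg]
    linarith
  calc ∑ k ∈ Finset.range n, T^[k] b ξ
      ≤ ∑ k ∈ Finset.range n, (2 * β (τ ^ (k + j)) + 2 * C / τ ^ j * D ξ * τ ^ k) :=
        Finset.sum_le_sum fun k _ => hterm k
    _ = 2 * ∑ k ∈ Finset.range n, β (τ ^ (k + j)) +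
        2 * C / τ ^ j * D ξ * ∑ k ∈ Finset.range n, τ ^ k := by
        rw [Finset.sum_add_distrib, ← Finset.mul_sum, ← Finset.mul_sum]
    _ ≤ 2 * (ε / 4) + 2 * C / τ ^ j * D ξ * (1 - τ)⁻¹ := by
        gcongr
        · refine le_trans ?_ hj.le
          exact Summable.sum_le_tsum _ (fun k _ => hβ0 _ (by positivity))
            ((summable_nat_add_iff j).2 hs)
        · exact (Summable.sum_le_tsum _ (fun k _ => by positivity)
            (summable_geometric_of_lt_one hτ0.le hτ1)).trans_eq
              (tsum_geometric_of_lt_one hτ0.le hτ1)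
    _ = ε / 2 + K * D ξ := by rw [hK]; field_simp; ring
    _ ≤ ε / 2 + K * (ε / (2 * (K + 1))) := by gcongr
    _ ≤ ε := by
        have : K * (ε / (2 * (K + 1))) ≤ ε / 2 := by
          rw [← mul_div_assoc, div_le_div_iff₀ (by positivity) (by norm_num)]
          nlinarith
        linarith

theorem abs_iterate_avg_le (hA : A1 x₀ y₀) (h3 : A3 p₀ p₁) {φ : ℝ → ℝ} {M : ℝ}
    (hφ : ∀ x ∈ Ioo (0 : ℝ) 1, |φ x| ≤ M) (n : ℕ) {x : ℝ} (hx : x ∈ Ioo (0 : ℝ) 1) :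
    |(avg (prob p₀ p₁) (fb x₀ y₀))^[n] φ x| ≤ M := by
  have hs := isSystem_prob_fb hA h3
  have h1 := hs.iterate_avg_le n (H := fun _ => M) (fun y hy => (abs_le.1 (hφ y hy)).2) x hx
  have h2 := hs.iterate_avg_le n (G := fun _ => -M) (fun y hy => (abs_le.1 (hφ y hy)).1) x hx
  rw [hs.iterate_avg_const n _ x hx] at h1 h2
  exact abs_le.2 ⟨h2, h1⟩

theorem exists_equicontinuous (hA : A1 x₀ y₀) (h2 : A2 p₀ p₁) (h3 : A3 p₀ p₁) {V : ℝ → ℝ}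
    {q B : ℝ} (hV : IsLyapunov x₀ y₀ p₀ p₁ V q B) {φ : ℝ → ℝ} (hφc : ContinuousOn φ (Ioo 0 1))
    {M : ℝ} (hφ : ∀ x ∈ Ioo (0 : ℝ) 1, |φ x| ≤ M) {c : ℝ} (hc : 0 < c) {ε : ℝ} (hε : 0 < ε) :
    ∃ r > 0, ∀ x ∈ Icc c (1 - c), ∀ y ∈ Ioo (0 : ℝ) 1, |coord x - coord y| ≤ r → ∀ n,
      |(avg (prob p₀ p₁) (fb x₀ y₀))^[n] φ x - (avg (prob p₀ p₁) (fb x₀ y₀))^[n] φ y| ≤ ε := by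
  have hM : 0 ≤ M := (abs_nonneg _).trans (hφ (1 / 2) (by norm_num))
  obtain ⟨θ, hθ, hsum⟩ := exists_sum_syncAvg_le hA h2 h3 hV
  have hV0 : ∀ x ∈ Ioo (0 : ℝ) 1, 0 ≤ V x := fun x hx => zero_le_one.trans (hV.one_le x hx)
  have hsub : Icc c (1 - c) ⊆ Ioo 0 1 := fun x hx => ⟨by linarith [hx.1], by linarith [hx.2]⟩
  set U := avg (prob p₀ p₁) (fb x₀ y₀) with hU
  set B' := B / (1 - q) with hB'
  have hBnn : 0 ≤ B' := div_nonneg hV.B_nonneg (by linarith [hV.q_lt_one])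
  obtain ⟨K, hK⟩ := (isCompact_Icc (a := c) (b := 1 - c)).bddAbove_image (hV.continuousOn.mono hsub)
  set K' := max K 0 with hK'
  have hVK : ∀ x ∈ Icc c (1 - c), V x ≤ K' := fun x hx =>
    (hK (mem_image_of_mem V hx)).trans (le_max_left _ _)
  have hKnn : 0 ≤ K' := le_max_right _ _
  set R := 8 * (M + 1) * (K' + B' + 1) / ε with hR
  have hR0 : 0 < R := by positivity
  obtain ⟨δ, hδ, hδV⟩ := hV.exists_mem_Icc R
  have hsubδ : Icc δ (1 - δ) ⊆ Ioo 0 1 := fun x hx => ⟨by linarith [hx.1], by linarith [hx.2]⟩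
  have huc := isCompact_Icc.uniformContinuousAt_of_continuousAt φ
    (fun x hx => hφc.continuousAt (Ioo_mem_nhds (hsubδ hx).1 (hsubδ hx).2))
    (Metric.dist_mem_uniformity (show 0 < ε / 4 by linarith))
  obtain ⟨r₁, hr₁, hr₁φ⟩ := Metric.mem_uniformity_dist.1 huc
  obtain ⟨r₂, hr₂, hr₂s⟩ := hsum (ε / (4 * (M + 1))) (by positivity)
  set r := min (r₂ / (1 + θ * K')) (r₁ * ε / (8 * (M + 1))) with hr
  refine ⟨r, by positivity, fun x hx y hy hxy n => ?_⟩
  have hξ : (x, y) ∈ Ioo (0 : ℝ) 1 ×ˢ Ioo (0 : ℝ) 1 := ⟨hsub hx, hy⟩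
  have hs := isSystem_sync hA h3 (coordDist (x, y))
  have hxy' : coordDist (x, y) ≤ r := hxy
  have hmain := hs.le_iterate_avg_add_sum
    (G := fun n η => |U^[n] φ η.1 - U^[n] φ η.2|)
    (b := M • fun η => ∑ b, |prob p₀ p₁ b η.1 - prob p₀ p₁ b η.2|) ?_ n (x, y) ⟨hξ, le_rfl⟩
  · refine hmain.trans ?_
    have h1 : (syncAvg x₀ y₀ p₀ p₁)^[n] (fun η => |φ η.1 - φ η.2|) (x, y) ≤
        ε / 4 + 2 * M / R * (V x + B') + 2 * M / r₁ * coordDist (x, y) := by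
      have h := hs.iterate_avg_le n (G := fun η => |φ η.1 - φ η.2|)
        (H := (fun _ => ε / 4) + (2 * M / R) • (V ∘ Prod.fst) + (2 * M / r₁) • coordDist) ?_
        (x, y) ⟨hξ, le_rfl⟩
      · rw [iterate_avg_add, iterate_avg_add, iterate_avg_smul, iterate_avg_smul] at h
        simp only [Pi.add_apply, Pi.smul_apply, smul_eq_mul] at h
        rw [hs.iterate_avg_const n _ (x, y) ⟨hξ, le_rfl⟩] at h
        have e1 := congrFun (iterate_syncAvg_comp_fst (x₀ := x₀) (y₀ := y₀) (p₀ := p₀) (p₁ := p₁)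
          n V) (x, y)
        rw [syncAvg] at e1
        rw [e1, Function.comp_apply] at h
        have e2 := iterate_syncAvg_coordDist_le hA h3 n hξ
        rw [syncAvg] at e2
        have e3 : (avg (prob p₀ p₁) (fb x₀ y₀))^[n] V x ≤ V x + B' := by
          refine (hV.iterate_avg_le hA h3 n (hsub hx)).trans ?_
          have := mul_le_of_le_one_left (hV0 x (hsub hx))
            (pow_le_one₀ (n := n) hV.q_nonneg hV.q_lt_one.le)
          linarith
        refine h.trans ?_
        gcongr
      · rintro η ⟨hη, -⟩
        simp only [Pi.add_apply, Pi.smul_apply, smul_eq_mul, Function.comp_apply]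
        have a1 := hV0 _ hη.1
        have a2 := coordDist_nonneg η
        have a3 : 0 ≤ 2 * M / R * V η.1 := by positivity
        have a4 : 0 ≤ 2 * M / r₁ * coordDist η := by positivity
        have a5 : |φ η.1 - φ η.2| ≤ 2 * M := by
          have := abs_le.1 (hφ _ hη.1)
          have := abs_le.1 (hφ _ hη.2)
          exact abs_le.2 ⟨by linarith, by linarith⟩
        rcases le_or_gt (V η.1) R with h | h
        · rcases lt_or_ge (coordDist η) r₁ with h' | h'
          · have := hr₁φ (a := η.1) (b := η.2)
              (by rw [Real.dist_eq]; exact (abs_sub_le_coord hη.1 hη.2).trans_lt h')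
              (hδV _ hη.1 h)
            simp only [mem_ofPred_eq, Real.dist_eq] at this
            linarith
          · have : 2 * M ≤ 2 * M / r₁ * coordDist η := by
              rw [div_mul_eq_mul_div, le_div_iff₀ hr₁]
              gcongr
            linarith
        · have : 2 * M ≤ 2 * M / R * V η.1 := by
            rw [div_mul_eq_mul_div, le_div_iff₀ hR0]
            gcongr
          linarith
    have h2' : ∀ k, (avg (syncProb p₀ p₁) (syncMap x₀ y₀))^[k]
        (M • fun η => ∑ b, |prob p₀ p₁ b η.1 - prob p₀ p₁ b η.2|) (x, y) =
        M * (syncAvg x₀ y₀ p₀ p₁)^[k] (fun η => ∑ b, |prob p₀ p₁ b η.1 - prob p₀ p₁ b η.2|)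
          (x, y) := by
      intro k
      rw [iterate_avg_smul]
      rfl
    have h3' := hr₂s (x, y) hξ (by
      calc coordDist (x, y) * (1 + θ * V x) ≤ r₂ / (1 + θ * K') * (1 + θ * K') := by
            have := hV0 x (hsub hx)
            gcongr
            · exact hxy'.trans (min_le_left _ _)
            · exact hVK x hx
        _ = r₂ := div_mul_cancel₀ _ (by positivity)) n
    have h4 : M * (ε / (4 * (M + 1))) ≤ ε / 4 := by
      rw [← mul_div_assoc, div_le_div_iff₀ (by positivity) (by norm_num)]
      nlinarith
    have h5 : 2 * M / R * (V x + B') ≤ ε / 4 := by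
      rw [div_mul_eq_mul_div, div_le_iff₀ hR0, hR]
      have : ε / 4 * (8 * (M + 1) * (K' + B' + 1) / ε) = 2 * (M + 1) * (K' + B' + 1) := by
        field_simp; ring
      rw [this]
      have := hVK x hx
      have := hV0 x (hsub hx)
      exact mul_le_mul (by linarith) (by linarith) (by linarith) (by linarith)
    have h6 : 2 * M / r₁ * coordDist (x, y) ≤ ε / 4 := by
      have : coordDist (x, y) ≤ r₁ * ε / (8 * (M + 1)) := hxy'.trans (min_le_right _ _)
      rw [le_div_iff₀ (by positivity)] at this
      rw [div_mul_eq_mul_div, div_le_iff₀ hr₁]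
      have := coordDist_nonneg (x, y)
      nlinarith
    have h7 := mul_le_mul_of_nonneg_left h3' hM
    simp only [h2', ← Finset.mul_sum]
    simp only [Function.iterate_zero, id_eq]
    rw [syncAvg] at h1
    linarith
  · rintro n η ⟨hη, -⟩
    simp only [Function.iterate_succ_apply', Pi.smul_apply, smul_eq_mul]
    have e : U (U^[n] φ) η.1 - U (U^[n] φ) η.2 = ∑ b, (prob p₀ p₁ b η.1 *
        (U^[n] φ (fb x₀ y₀ b η.1) - U^[n] φ (fb x₀ y₀ b η.2)) +
        (prob p₀ p₁ b η.1 - prob p₀ p₁ b η.2) * U^[n] φ (fb x₀ y₀ b η.2)) := by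
      simp only [hU, avg, ← Finset.sum_sub_distrib]
      exact Finset.sum_congr rfl fun b _ => by ring
    rw [e, avg, Finset.mul_sum, ← Finset.sum_add_distrib]
    refine (Finset.abs_sum_le_sum_abs _ _).trans (Finset.sum_le_sum fun b _ => ?_)
    refine (abs_add_le _ _).trans (add_le_add ?_ ?_)
    · rw [abs_mul, abs_of_nonneg ((isSystem_prob_fb hA h3).nonneg b _ hη.1)]
      exact le_rfl
    · rw [abs_mul, mul_comm]
      gcongr
      exact abs_iterate_avg_le hA h3 hφ n (fb_mem hA b hη.2)

end Synchronous

/-! ### Asymptotic stability of the averaging operator -/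

section Independent

variable {x₀ y₀ : ℝ} {p₀ p₁ : ℝ → ℝ}

/-- The weights of the independent coupling. -/
def indepProb (p₀ p₁ : ℝ → ℝ) (b : Bool × Bool) (ξ : ℝ × ℝ) : ℝ :=
  prob p₀ p₁ b.1 ξ.1 * prob p₀ p₁ b.2 ξ.2

/-- The maps of the independent coupling. -/
noncomputable def indepMap (x₀ y₀ : ℝ) (b : Bool × Bool) : ℝ × ℝ → ℝ × ℝ :=
  Prod.map (fb x₀ y₀ b.1) (fb x₀ y₀ b.2)

/-- The averaging operator of the independent coupling. -/
noncomputable def indepAvg (x₀ y₀ : ℝ) (p₀ p₁ : ℝ → ℝ) : (ℝ × ℝ → ℝ) → ℝ × ℝ → ℝ :=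
  avg (indepProb p₀ p₁) (indepMap x₀ y₀)

theorem isSystem_indep (hA : A1 x₀ y₀) (h3 : A3 p₀ p₁) :
    IsSystem (indepProb p₀ p₁) (indepMap x₀ y₀) (Ioo (0 : ℝ) 1 ×ˢ Ioo (0 : ℝ) 1) where
  mapsTo b _ hξ := ⟨fb_mem hA b.1 hξ.1, fb_mem hA b.2 hξ.2⟩
  nonneg b _ hξ := mul_nonneg ((isSystem_prob_fb hA h3).nonneg b.1 _ hξ.1)
    ((isSystem_prob_fb hA h3).nonneg b.2 _ hξ.2)
  sum_eq_one ξ hξ := by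
    simp only [indepProb]
    rw [Fintype.sum_prod_type]
    dsimp only
    rw [← Finset.sum_mul_sum, (isSystem_prob_fb hA h3).sum_eq_one _ hξ.1,
      (isSystem_prob_fb hA h3).sum_eq_one _ hξ.2, one_mul]

theorem indepAvg_fst_snd (hA : A1 x₀ y₀) (h3 : A3 p₀ p₁) (G H : ℝ → ℝ) {ξ : ℝ × ℝ}
    (hξ : ξ ∈ Ioo (0 : ℝ) 1 ×ˢ Ioo (0 : ℝ) 1) :
    indepAvg x₀ y₀ p₀ p₁ (fun η => G η.1 + H η.2) ξ =
      avg (prob p₀ p₁) (fb x₀ y₀) G ξ.1 + avg (prob p₀ p₁) (fb x₀ y₀) H ξ.2 := by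
  have e1 := (isSystem_prob_fb hA h3).sum_eq_one _ hξ.1
  have e2 := (isSystem_prob_fb hA h3).sum_eq_one _ hξ.2
  simp only [indepAvg, avg, indepProb, indepMap, Prod.map_fst, Prod.map_snd]
  rw [Fintype.sum_prod_type]
  calc _ = ∑ i, ∑ j, (prob p₀ p₁ i ξ.1 * G (fb x₀ y₀ i ξ.1) * prob p₀ p₁ j ξ.2 +
        prob p₀ p₁ i ξ.1 * (prob p₀ p₁ j ξ.2 * H (fb x₀ y₀ j ξ.2))) :=
        Finset.sum_congr rfl fun i _ => Finset.sum_congr rfl fun j _ => by ring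
    _ = _ := by
        simp only [Finset.sum_add_distrib]
        rw [← Finset.sum_mul_sum, ← Finset.sum_mul_sum, e1, e2, mul_one, one_mul]

theorem abs_avg_sub_avg_le (hA : A1 x₀ y₀) (h3 : A3 p₀ p₁) (ψ : ℝ → ℝ) {ξ : ℝ × ℝ}
    (hξ : ξ ∈ Ioo (0 : ℝ) 1 ×ˢ Ioo (0 : ℝ) 1) :
    |avg (prob p₀ p₁) (fb x₀ y₀) ψ ξ.1 - avg (prob p₀ p₁) (fb x₀ y₀) ψ ξ.2| ≤
      indepAvg x₀ y₀ p₀ p₁ (fun η => |ψ η.1 - ψ η.2|) ξ := by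
  have hs := isSystem_indep hA h3
  have h := indepAvg_fst_snd hA h3 ψ ((-1 : ℝ) • ψ) hξ
  rw [avg_smul, Pi.smul_apply, smul_eq_mul, neg_one_mul, ← sub_eq_add_neg] at h
  rw [← h]
  simp only [indepAvg, avg]
  refine (Finset.abs_sum_le_sum_abs _ _).trans (Finset.sum_le_sum fun b _ => ?_)
  rw [abs_mul, abs_of_nonneg (hs.nonneg b ξ hξ), Pi.smul_apply, smul_eq_mul, neg_one_mul,
    ← sub_eq_add_neg]

theorem eventually_abs_iterate_avg_sub_le (hA : A1 x₀ y₀) (h2 : A2 p₀ p₁) (h3 : A3 p₀ p₁)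
    {V : ℝ → ℝ} {q B : ℝ} (hV : IsLyapunov x₀ y₀ p₀ p₁ V q B) {φ : ℝ → ℝ}
    (hφc : ContinuousOn φ (Ioo 0 1)) {M : ℝ} (hφ : ∀ x ∈ Ioo (0 : ℝ) 1, |φ x| ≤ M) {ε : ℝ}
    (hε : 0 < ε) :
    ∀ᶠ n in atTop, ∀ x ∈ Ioo (0 : ℝ) 1, ∀ y ∈ Ioo (0 : ℝ) 1,
      |(avg (prob p₀ p₁) (fb x₀ y₀))^[n] φ x - (avg (prob p₀ p₁) (fb x₀ y₀))^[n] φ y| ≤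
        ε * (V x + V y) := by
  have hM : 0 ≤ M := (abs_nonneg _).trans (hφ (1 / 2) (by norm_num))
  have hq0 := hV.q_nonneg
  have hq1 := hV.q_lt_one
  have hB0 := hV.B_nonneg
  have hs := isSystem_indep hA h3
  obtain ⟨p, hp0, hp1, hp⟩ := exists_le_prob h3
  obtain ⟨c, hc, hcon⟩ := exists_iterate_contraction hA
  obtain ⟨r, hr, hequi⟩ := exists_equicontinuous hA h2 h3 hV hφc hφ hc (half_pos hε)
  set U := avg (prob p₀ p₁) (fb x₀ y₀) with hU
  set T := avg (indepProb p₀ p₁) (indepMap x₀ y₀) with hT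
  set S := Ioo (0 : ℝ) 1 ×ˢ Ioo (0 : ℝ) 1
  set V₂ : ℝ × ℝ → ℝ := fun η => V η.1 + V η.2 with hV₂
  have hV₂2 : ∀ ξ ∈ S, 2 ≤ V₂ ξ := fun ξ hξ => by
    have := hV.one_le _ hξ.1
    have := hV.one_le _ hξ.2
    simp only [hV₂]
    linarith
  have hdrift : ∀ ξ ∈ S, T V₂ ξ ≤ q * V₂ ξ + 2 * B := by
    intro ξ hξ
    refine (indepAvg_fst_snd hA h3 V V hξ).trans_le ?_
    have := hV.drift _ hξ.1
    have := hV.drift _ hξ.2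
    simp only [hV₂]
    linarith
  set B' := 2 * B / (1 - q) with hB'
  have hBnn : 0 ≤ B' := div_nonneg (by linarith) (by linarith)
  set R := max 1 (2 * B' / (1 - q)) with hR
  have hRB : 2 * B' ≤ (1 - q) * R := by
    have : 2 * B' / (1 - q) ≤ R := le_max_right _ _
    rw [div_le_iff₀ (by linarith)] at this
    linarith
  obtain ⟨δ, hδ, hδV⟩ := hV.exists_mem_Icc R
  obtain ⟨n, hn, hcn⟩ := hcon δ hδ (r * δ) (by positivity)
  set κ := ((p ^ 2) ^ 2) ^ n with hκ
  have hκ0 : 0 < κ := by positivity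
  obtain ⟨θ, hθ, ρ, hρ0, hρ1, hw⟩ :=
    exists_weight_contraction hq0 hq1 hBnn hκ0 (le_max_left _ _) hRB
  set W : ℝ × ℝ → ℝ := fun η => 1 + θ * V₂ η with hW
  set H : ℕ → ℝ × ℝ → ℝ := fun k η => |U^[k] φ η.1 - U^[k] φ η.2| - ε / 2 with hH
  have hW1 : ∀ ξ ∈ S, 1 ≤ W ξ := fun ξ hξ => by
    have := hV₂2 ξ hξ
    have : 0 ≤ θ * V₂ ξ := by positivity
    simp only [hW]
    linarith
  have hHT : ∀ m k, ∀ ξ ∈ S, H (k + m) ξ ≤ T^[m] (H k) ξ := by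
    intro m k
    induction m with
    | zero => intro ξ _; exact le_rfl
    | succ m ih =>
      intro ξ hξ
      rw [Function.iterate_succ_apply']
      refine le_trans ?_ (hs.avg_le ih ξ hξ)
      have e : H (k + m) = (fun η => |U^[k + m] φ η.1 - U^[k + m] φ η.2|) +
          fun _ => -(ε / 2) := by
        ext η
        simp only [hH, Pi.add_apply]
        ring
      rw [e, avg_add, Pi.add_apply, hs.avg_const _ ξ hξ]
      simp only [hH, ← add_assoc, Function.iterate_succ_apply']
      have := abs_avg_sub_avg_le hA h3 (U^[k + m] φ) hξ
      rw [indepAvg] at this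
      linarith
  have hHg : ∀ k, ∀ ξ ∈ S, V₂ ξ ≤ R →
      H k ((indepMap x₀ y₀ (false, false) ∘ indepMap x₀ y₀ (true, true))^[n] ξ) ≤ 0 := by
    intro k ξ hξ hξR
    have v1 := hV.one_le _ hξ.1
    have v2 := hV.one_le _ hξ.2
    simp only [hV₂] at hξR
    have m1 := hδV _ hξ.1 (by linarith)
    have m2 := hδV _ hξ.2 (by linarith)
    obtain ⟨c1, c2⟩ := hcn _ m1 _ m2
    have c3 : |coord ξ.1 - coord ξ.2| ≤ 1 / δ := by
      refine (abs_coord_sub_le hδ m1 m2).trans ?_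
      gcongr
      exact abs_le.2 ⟨by linarith [hξ.1.1, hξ.2.2], by linarith [hξ.1.2, hξ.2.1]⟩
    have e : (indepMap x₀ y₀ (false, false) ∘ indepMap x₀ y₀ (true, true))^[n] ξ =
        ((fb x₀ y₀ false ∘ fb x₀ y₀ true)^[n] ξ.1, (fb x₀ y₀ false ∘ fb x₀ y₀ true)^[n] ξ.2) := by
      rw [indepMap, indepMap, Prod.map_comp_map, Prod.map_iterate, Prod.map_apply']
    have hmem : MapsTo (fb x₀ y₀ false ∘ fb x₀ y₀ true)^[n] (Ioo 0 1) (Ioo 0 1) :=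
      ((fb_mem hA false).comp (fb_mem hA true)).iterate n
    have := hequi _ c1 _ (hmem hξ.2) (c2.trans (by
      calc r * δ * |coord ξ.1 - coord ξ.2| ≤ r * δ * (1 / δ) := by gcongr
        _ = r := by field_simp)) k
    rw [e]
    simp only [hH]
    linarith
  have hstep : ∀ a, 0 ≤ a → ∀ k, (∀ ξ ∈ S, H k ξ ≤ a * W ξ) →
      ∀ ξ ∈ S, H (k + 2 * n) ξ ≤ a * ρ * W ξ := by
    intro a ha k hk ξ hξ
    have h1 := hs.le_iterate_avg (p := p ^ 2) (by positivity)
      (fun b η hη => by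
        rw [sq]
        exact mul_le_mul (hp b.1 _ hη.1) (hp b.2 _ hη.2) hp0.le
          ((isSystem_prob_fb hA h3).nonneg b.1 _ hη.1)) (true, true) (false, false) n
      (H := a • W - H k) (fun η hη => sub_nonneg.2 (hk η hη)) ξ hξ
    rw [iterate_avg_sub, iterate_avg_smul, show W = (fun _ => 1) + θ • V₂ from rfl,
      iterate_avg_add, iterate_avg_smul] at h1
    simp only [Pi.sub_apply, Pi.smul_apply, Pi.add_apply, smul_eq_mul] at h1
    rw [hs.iterate_avg_const _ _ ξ hξ, ← hT] at h1
    have hmem : (indepMap x₀ y₀ (false, false) ∘ indepMap x₀ y₀ (true, true))^[n] ξ ∈ S :=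
      ((hs.mapsTo (false, false)).comp (hs.mapsTo (true, true))).iterate n hξ
    set ζ := (indepMap x₀ y₀ (false, false) ∘ indepMap x₀ y₀ (true, true))^[n] ξ
    have h2 : T^[2 * n] V₂ ξ ≤ q * V₂ ξ + B' := by
      refine (hs.iterate_avg_le_of_drift hq0 hq1 (by linarith) hdrift (2 * n) ξ hξ).trans ?_
      have : q ^ (2 * n) ≤ q := pow_le_of_le_one hq0 hq1.le (by omega)
      have := hV₂2 ξ hξ
      gcongr
    have h3 := hHT (2 * n) k ξ hξ
    have h4 := hw (V₂ ξ) (if V₂ ξ ≤ R then 1 - κ else 1) (T^[2 * n] V₂ ξ)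
      (by linarith [hV₂2 ξ hξ]) (by split_ifs <;> linarith) h2 (fun h => by rw [if_pos h])
    have h5 : T^[2 * n] (H k) ξ ≤
        a * ((if V₂ ξ ≤ R then 1 - κ else 1) + θ * T^[2 * n] V₂ ξ) := by
      have hpos : 0 ≤ a * (1 + θ * V₂ ζ) - H k ζ := sub_nonneg.2 (hk ζ hmem)
      split_ifs with h
      · have g1 := hHg k ξ hξ h
        have g2 := hW1 ζ hmem
        have g3 : κ * a ≤ κ * (a * (1 + θ * V₂ ζ) - H k ζ) := by
          have : a * 1 ≤ a * (1 + θ * V₂ ζ) := by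
            gcongr
          gcongr
          linarith
        linarith
      · have : 0 ≤ κ * (a * (1 + θ * V₂ ζ) - H k ζ) := by positivity
        linarith
    calc H (k + 2 * n) ξ ≤ a * ((if V₂ ξ ≤ R then 1 - κ else 1) + θ * T^[2 * n] V₂ ξ) :=
          h3.trans h5
      _ ≤ a * (ρ * (1 + θ * V₂ ξ)) := by gcongr
      _ = a * ρ * W ξ := by simp only [hW]; ring
  have hbound : ∀ j k, ∀ ξ ∈ S, H (k + j * (2 * n)) ξ ≤ 2 * M * ρ ^ j * W ξ := by
    intro j k
    induction j with
    | zero =>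
      intro ξ hξ
      have a1 := abs_le.1 (abs_iterate_avg_le hA h3 hφ k hξ.1)
      have a2 := abs_le.1 (abs_iterate_avg_le hA h3 hφ k hξ.2)
      have a3 : |U^[k] φ ξ.1 - U^[k] φ ξ.2| ≤ 2 * M :=
        abs_le.2 ⟨by linarith, by linarith⟩
      have a4 : 2 * M * 1 ≤ 2 * M * W ξ := by
        gcongr
        exact hW1 ξ hξ
      simp only [hH, zero_mul, add_zero, pow_zero, mul_one]
      linarith
    | succ j ih =>
      intro ξ hξ
      have := hstep (2 * M * ρ ^ j) (by positivity) _ ih ξ hξ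
      rw [pow_succ, ← mul_assoc (2 * M)]
      rwa [show k + (j + 1) * (2 * n) = k + j * (2 * n) + 2 * n by ring]
  obtain ⟨j, hj⟩ := exists_pow_lt_of_lt_one
    (show 0 < ε / (4 * (M + 1) * (1 + θ)) by positivity) hρ1
  filter_upwards [eventually_ge_atTop (j * (2 * n))] with k hk x hx y hy
  obtain ⟨i, rfl⟩ := Nat.exists_eq_add_of_le' hk
  have hξ : (x, y) ∈ S := ⟨hx, hy⟩
  have h1 := hbound j i (x, y) hξ
  have hV2 := hV₂2 _ hξ
  have h2 : 2 * M * ρ ^ j * W (x, y) ≤ ε / 2 * V₂ (x, y) := by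
    have e1 : W (x, y) ≤ (1 + θ) * V₂ (x, y) := by
      simp only [hW]
      linarith
    rw [lt_div_iff₀ (by positivity)] at hj
    calc 2 * M * ρ ^ j * W (x, y) ≤ 2 * (M + 1) * ρ ^ j * ((1 + θ) * V₂ (x, y)) := by
          have := hW1 _ hξ
          gcongr
          linarith
      _ = ρ ^ j * (4 * (M + 1) * (1 + θ)) / 2 * V₂ (x, y) := by ring
      _ ≤ ε / 2 * V₂ (x, y) := by gcongr
  have h3 : ε / 2 ≤ ε / 2 * V₂ (x, y) := by nlinarith
  simp only [hH] at h1
  have h4 : ε * (V x + V y) = ε / 2 * V₂ (x, y) + ε / 2 * V₂ (x, y) := by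
    simp only [hV₂]
    ring
  linarith

end Independent

/-! ### Stationary measures -/

section Stationary

variable {x₀ y₀ : ℝ} {p₀ p₁ : ℝ → ℝ}

theorem continuousOn_prob (h3 : A3 p₀ p₁) (b : Bool) :
    ContinuousOn (prob p₀ p₁ b) (Ioo 0 1) := by
  cases b
  · exact h3.1.mono Ioo_subset_Icc_self
  · exact h3.2.1.mono Ioo_subset_Icc_self

theorem continuousOn_iterate_avg (hA : A1 x₀ y₀) (h3 : A3 p₀ p₁) {φ : ℝ → ℝ}
    (hφ : ContinuousOn φ (Ioo 0 1)) (n : ℕ) :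
    ContinuousOn ((avg (prob p₀ p₁) (fb x₀ y₀))^[n] φ) (Ioo 0 1) := by
  induction n with
  | zero => exact hφ
  | succ n ih =>
    rw [Function.iterate_succ_apply']
    exact continuousOn_finsetSum _ fun b _ => (continuousOn_prob h3 b).mul
      (ih.comp (continuous_fb hA b).continuousOn (fb_mem hA b))

theorem Stationary.ae_mem {μ : Measure ℝ} (hμ : Stationary x₀ y₀ p₀ p₁ μ) :
    ∀ᵐ x ∂μ, x ∈ Ioo (0 : ℝ) 1 := by
  have := hμ.1
  exact (prob_compl_eq_zero_iff measurableSet_Ioo).2 hμ.2.1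

theorem Stationary.eq_sum_map_withDensity (hA : A1 x₀ y₀) {μ : Measure ℝ}
    (hμ : Stationary x₀ y₀ p₀ p₁ μ) :
    μ = ∑ b, (μ.withDensity fun x => ENNReal.ofReal (prob p₀ p₁ b x)).map (fb x₀ y₀ b) := by
  have hmem := hμ.ae_mem
  ext A hAm
  have hI : ∀ b, (fb x₀ y₀ b ⁻¹' (A ∩ Ioo 0 1) : Set ℝ) =ᵐ[μ] fb x₀ y₀ b ⁻¹' A := by
    intro b
    filter_upwards [hmem] with x hx
    exact propext ⟨fun h => h.1, fun h => ⟨h, fb_mem hA b hx⟩⟩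
  have h1 : μ A = μ (A ∩ Ioo 0 1) := measure_congr (by
    filter_upwards [hmem] with x hx
    exact propext ⟨fun h => ⟨h, hx⟩, fun h => h.1⟩)
  rw [h1, hμ.2.2 _ (hAm.inter measurableSet_Ioo) inter_subset_right, Fintype.sum_bool,
    Measure.add_apply, Measure.map_apply (continuous_fb hA _).measurable hAm,
    Measure.map_apply (continuous_fb hA _).measurable hAm,
    withDensity_apply _ ((continuous_fb hA _).measurable hAm),
    withDensity_apply _ ((continuous_fb hA _).measurable hAm), Pop, add_comm,
    ← Measure.restrict_congr_set (hI true), ← Measure.restrict_congr_set (hI false)]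
  rfl

theorem Stationary.integral_avg (hA : A1 x₀ y₀) (h3 : A3 p₀ p₁) {μ : Measure ℝ}
    (hμ : Stationary x₀ y₀ p₀ p₁ μ) {ψ : ℝ → ℝ} (hψ : ContinuousOn ψ (Ioo 0 1)) {M : ℝ}
    (hM : ∀ x ∈ Ioo (0 : ℝ) 1, |ψ x| ≤ M) :
    ∫ x, avg (prob p₀ p₁) (fb x₀ y₀) ψ x ∂μ = ∫ x, ψ x ∂μ := by
  have := hμ.1
  have hmem := hμ.ae_mem
  have hμI : μ.restrict (Ioo 0 1) = μ := Measure.restrict_eq_self_of_ae_mem hmem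
  have hsm : ∀ {g : ℝ → ℝ}, ContinuousOn g (Ioo 0 1) → AEStronglyMeasurable g μ := by
    intro g hg
    rw [← hμI]
    exact hg.aestronglyMeasurable measurableSet_Ioo
  have hsum := hμ.eq_sum_map_withDensity hA
  set ν : Bool → Measure ℝ := fun b =>
    (μ.withDensity fun x => ENNReal.ofReal (prob p₀ p₁ b x)).map (fb x₀ y₀ b) with hν
  have hle : ∀ b, ν b ≤ μ := fun b => by
    conv_rhs => rw [hsum]
    exact Finset.single_le_sum (f := ν) (fun _ _ => Measure.zero_le _) (Finset.mem_univ b)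
  have hint : Integrable ψ μ :=
    Integrable.of_bound (hsm hψ) M (by filter_upwards [hmem] with x hx using hM x hx)
  have hprob : ∀ b, AEMeasurable (fun x => ENNReal.ofReal (prob p₀ p₁ b x)) μ := fun b =>
    (hsm (continuousOn_prob h3 b)).aemeasurable.ennreal_ofReal
  have hterm : ∀ b, ∫ x, ψ x ∂ν b = ∫ x, prob p₀ p₁ b x * ψ (fb x₀ y₀ b x) ∂μ := by
    intro b
    rw [hν]
    dsimp only
    rw [integral_map (continuous_fb hA b).aemeasurable ((hsm hψ).mono_measure (hle b)),
      integral_withDensity_eq_integral_toReal_smul₀ (hprob b) (by simp)]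
    refine integral_congr_ae ?_
    filter_upwards [hmem] with x hx
    rw [ENNReal.toReal_ofReal ((isSystem_prob_fb hA h3).nonneg b x hx), smul_eq_mul]
  have hI : ∀ b, Integrable (fun x => prob p₀ p₁ b x * ψ (fb x₀ y₀ b x)) μ := by
    intro b
    have hs := isSystem_prob_fb hA h3
    refine Integrable.of_bound (hsm ((continuousOn_prob h3 b).mul
      (hψ.comp (continuous_fb hA b).continuousOn (fb_mem hA b)))) M ?_
    filter_upwards [hmem] with x hx
    rw [Real.norm_eq_abs, abs_mul, abs_of_nonneg (hs.nonneg b x hx)]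
    have h1 : prob p₀ p₁ b x ≤ 1 := by
      rw [← hs.sum_eq_one x hx]
      exact Finset.single_le_sum (f := fun b => prob p₀ p₁ b x)
        (fun b _ => hs.nonneg b x hx) (Finset.mem_univ b)
    exact (mul_le_of_le_one_left (abs_nonneg _) h1).trans (hM _ (fb_mem hA b hx))
  conv_rhs => rw [hsum]
  simp only [avg]
  rw [integral_finsetSum_measure fun b _ => hint.mono_measure (hle b),
    integral_finsetSum _ fun b _ => hI b]
  exact Finset.sum_congr rfl fun b _ => (hterm b).symm

/-- The iterates of the averaging operator converge to the mean with respect to a stationary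
measure, locally uniformly. -/
theorem Stationary.exists_abs_iterate_avg_sub_le (hA : A1 x₀ y₀) (h2 : A2 p₀ p₁)
    (h3 : A3 p₀ p₁) {V : ℝ → ℝ} {q B : ℝ} (hV : IsLyapunov x₀ y₀ p₀ p₁ V q B) {μ : Measure ℝ}
    (hμ : Stationary x₀ y₀ p₀ p₁ μ) {φ : ℝ → ℝ} (hφc : ContinuousOn φ (Ioo 0 1)) {M : ℝ}
    (hφ : ∀ x ∈ Ioo (0 : ℝ) 1, |φ x| ≤ M) {ε : ℝ} (hε : 0 < ε) :
    ∃ n, ∀ x ∈ Ioo (0 : ℝ) 1,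
      |(avg (prob p₀ p₁) (fb x₀ y₀))^[n] φ x - ∫ t, φ t ∂μ| ≤ ε * V x := by
  have := hμ.1
  have hmem := hμ.ae_mem
  have hμI : μ.restrict (Ioo 0 1) = μ := Measure.restrict_eq_self_of_ae_mem hmem
  have hhalf : (1 / 2 : ℝ) ∈ Ioo (0 : ℝ) 1 := by norm_num
  have hVh := hV.one_le _ hhalf
  set u : ℕ → ℝ → ℝ := fun n => (avg (prob p₀ p₁) (fb x₀ y₀))^[n] φ with hu
  have hsm : ∀ n, AEStronglyMeasurable (u n) μ := by
    intro n
    rw [← hμI]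
    exact (continuousOn_iterate_avg hA h3 hφc n).aestronglyMeasurable measurableSet_Ioo
  have hub : ∀ n, ∀ x ∈ Ioo (0 : ℝ) 1, |u n x| ≤ M := fun n x hx =>
    abs_iterate_avg_le hA h3 hφ n hx
  have hint : ∀ n, Integrable (u n) μ := fun n =>
    Integrable.of_bound (hsm n) M (by filter_upwards [hmem] with x hx using hub n x hx)
  have hmean : ∀ n, ∫ t, u n t ∂μ = ∫ t, φ t ∂μ := by
    intro n
    induction n with
    | zero => rfl
    | succ n ih =>
      rw [← ih, ← hμ.integral_avg hA h3 (continuousOn_iterate_avg hA h3 hφc n) (hub n)]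
      simp only [hu, Function.iterate_succ_apply']
  have hlim : Tendsto (fun n => ∫ t, (u n (1 / 2) - u n t) ∂μ) atTop (𝓝 (∫ _, (0 : ℝ) ∂μ)) := by
    refine tendsto_integral_of_dominated_convergence (fun _ => 2 * M)
      (fun n => aestronglyMeasurable_const.sub (hsm n)) (integrable_const _) (fun n => ?_) ?_
    · filter_upwards [hmem] with x hx
      refine (norm_sub_le _ _).trans ?_
      have := hub n _ hhalf
      have := hub n _ hx
      simp only [Real.norm_eq_abs]
      linarith
    · filter_upwards [hmem] with x hx
      have hVx := hV.one_le x hx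
      rw [Metric.tendsto_nhds]
      intro δ hδ
      filter_upwards [eventually_abs_iterate_avg_sub_le hA h2 h3 hV hφc hφ
        (show 0 < δ / (2 * (V (1 / 2) + V x)) by positivity)] with n hn
      rw [dist_zero_right, Real.norm_eq_abs]
      refine (hn _ hhalf x hx).trans_lt ?_
      rw [div_mul_eq_mul_div, div_lt_iff₀ (by positivity)]
      have : 0 < δ * (V (1 / 2) + V x) := by positivity
      linarith
  rw [integral_zero, Metric.tendsto_nhds] at hlim
  set η := ε / (2 + V (1 / 2)) with hη
  have hη0 : 0 < η := by positivity
  obtain ⟨n, h1, h2⟩ := ((hlim η hη0).and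
    (eventually_abs_iterate_avg_sub_le hA h2 h3 hV hφc hφ hη0)).exists
  refine ⟨n, fun x hx => ?_⟩
  rw [dist_zero_right, Real.norm_eq_abs, integral_sub (integrable_const _) (hint n), hmean,
    integral_const, probReal_univ, one_smul] at h1
  have hVx := hV.one_le x hx
  calc |u n x - ∫ t, φ t ∂μ|
      ≤ |u n x - u n (1 / 2)| + |u n (1 / 2) - ∫ t, φ t ∂μ| := abs_sub_le _ _ _
    _ ≤ η * (V x + V (1 / 2)) + η := add_le_add (h2 x hx _ hhalf) h1.le
    _ ≤ η * (2 + V (1 / 2)) * V x := by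
        have : 0 ≤ η * ((1 + V (1 / 2)) * (V x - 1)) := by
          have := sub_nonneg.2 hVx
          positivity
        linarith
    _ = ε * V x := by rw [hη, div_mul_cancel₀ _ (by positivity)]

end Stationary

/-! ### Averages along trajectories -/

section Trajectories

theorem tendsto_average_sub_of_increment {f g : ℕ → ℝ} {M : ℝ} (hg : ∀ n, |g n| ≤ M)
    (h : Tendsto (fun n : ℕ => (∑ k ∈ Finset.range n, (f (k + 1) - g k)) / n) atTop (𝓝 0)) :
    Tendsto (fun n : ℕ => (∑ k ∈ Finset.range n, f (k + 1)) / n -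
      (∑ k ∈ Finset.range n, g (k + 1)) / n) atTop (𝓝 0) := by
  have h1 : Tendsto (fun n : ℕ => (g 0 - g n) / n) atTop (𝓝 0) := by
    refine squeeze_zero_norm (fun n => ?_) (tendsto_const_div_atTop_nhds_zero_nat (2 * M))
    rw [norm_div, Real.norm_natCast]
    gcongr
    refine (norm_sub_le _ _).trans ?_
    have := hg 0
    have := hg n
    simp only [Real.norm_eq_abs]
    linarith
  have h2 := h.add h1
  rw [add_zero] at h2
  refine h2.congr fun n => ?_
  rw [← add_div, ← sub_div, ← Finset.sum_range_sub', ← Finset.sum_add_distrib,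
    ← Finset.sum_sub_distrib]
  congr 1
  exact Finset.sum_congr rfl fun k _ => by ring

theorem exists_eventually_average_le_of_increment {f g : ℕ → ℝ} {q B : ℝ} (hf : ∀ n, 0 ≤ f n)
    (hq0 : 0 ≤ q) (hq1 : q < 1) (hg : ∀ n, g n ≤ q * f n + B)
    (h : Tendsto (fun n : ℕ => (∑ k ∈ Finset.range n, (f (k + 1) - g k)) / n) atTop (𝓝 0)) :
    ∃ L, ∀ᶠ n : ℕ in atTop, (∑ k ∈ Finset.range n, f (k + 1)) / n ≤ L := by
  refine ⟨(1 + f 0 + B) / (1 - q), ?_⟩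
  filter_upwards [h.eventually_lt_const one_pos, eventually_ge_atTop 1] with n hn hn1
  have hn0 : (1 : ℝ) ≤ n := by exact_mod_cast hn1
  rw [div_lt_one (by positivity), Finset.sum_sub_distrib] at hn
  have h1 : ∑ k ∈ Finset.range n, g k ≤ q * ∑ k ∈ Finset.range n, f k + n * B := by
    rw [Finset.mul_sum]
    refine (Finset.sum_le_sum fun k _ => hg k).trans ?_
    rw [Finset.sum_add_distrib, Finset.sum_const, Finset.card_range, nsmul_eq_mul]
  have h2 : ∑ k ∈ Finset.range n, f k ≤ f 0 + ∑ k ∈ Finset.range n, f (k + 1) := by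
    have e1 := Finset.sum_range_succ f n
    have e2 := Finset.sum_range_succ' f n
    have := hf n
    linarith
  have h3 : q * ∑ k ∈ Finset.range n, f k ≤
      q * (f 0 + ∑ k ∈ Finset.range n, f (k + 1)) := by gcongr
  have h4 : q * f 0 ≤ n * f 0 := by
    have := hf 0
    gcongr
    linarith
  rw [div_le_div_iff₀ (by positivity) (by linarith)]
  linarith

end Trajectories

section StrongLaw

variable {x₀ y₀ : ℝ} {p₀ p₁ : ℝ → ℝ} {Pm : ℝ → Measure (ℕ → Bool)} {x : ℝ}

theorem IsLyapunov.integral_sq_iter_le (hA : A1 x₀ y₀) (h3 : A3 p₀ p₁) {V : ℝ → ℝ} {q B : ℝ}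
    (hV : IsLyapunov x₀ y₀ p₀ p₁ V q B) (hPm : IsKernel x₀ y₀ p₀ p₁ Pm)
    (hx : x ∈ Ioo (0 : ℝ) 1) (n : ℕ) :
    ∫ ω, V (iter x₀ y₀ ω n x) ^ 2 ∂(Pm x) ≤ V x ^ 2 + B / (1 - q) := by
  have := isProbabilityMeasure_kernel hPm hx
  have hs := isSystem_prob_fb hA h3
  have hq1 : 0 < 1 - q := sub_pos.2 hV.q_lt_one
  have hB := hV.B_nonneg
  have hint : ∀ (n : ℕ) (ψ : ℝ → ℝ), Integrable (fun ω => ψ (iter x₀ y₀ ω n x)) (Pm x) :=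
    fun n ψ => integrable_of_dependsOn (n := n) fun ω ω' h =>
      congrArg ψ (dependsOn_iter (x₀ := x₀) (y₀ := y₀) n x h)
  induction n with
  | zero =>
    simp only [iter, integral_const, probReal_univ, one_smul]
    have : 0 ≤ B / (1 - q) := by positivity
    linarith
  | succ n ih =>
    have h := integral_mul_iter_succ hPm hs hx (n := n) (Φ := fun _ => 1)
      (fun _ _ _ => rfl) (fun z => V z ^ 2)
    simp only [one_mul] at h
    rw [h]
    calc ∫ ω, avg (prob p₀ p₁) (fb x₀ y₀) (fun z => V z ^ 2) (iter x₀ y₀ ω n x) ∂(Pm x)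
        ≤ ∫ ω, (q * V (iter x₀ y₀ ω n x) ^ 2 + B) ∂(Pm x) :=
          integral_mono (hint n _) (hint n fun z => q * V z ^ 2 + B) fun ω =>
            hV.drift_sq _ (iter_mem hs.mapsTo ω n hx)
      _ = q * ∫ ω, V (iter x₀ y₀ ω n x) ^ 2 ∂(Pm x) + B := by
          rw [integral_add (hint n fun z => q * V z ^ 2) (integrable_const _),
            integral_const_mul, integral_const, probReal_univ, one_smul]
      _ ≤ q * (V x ^ 2 + B / (1 - q)) + B := by
          have := hV.q_nonneg
          gcongr
      _ = q * V x ^ 2 + B / (1 - q) := by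
          field_simp
          ring
      _ ≤ V x ^ 2 + B / (1 - q) := by
          have := mul_le_of_le_one_left (sq_nonneg (V x)) hV.q_lt_one.le
          linarith

theorem Stationary.ae_tendsto_average (hA : A1 x₀ y₀) (h2 : A2 p₀ p₁) (h3 : A3 p₀ p₁)
    (h4 : A4 x₀ y₀ p₀ p₁) (hPm : IsKernel x₀ y₀ p₀ p₁ Pm) {μ : Measure ℝ}
    (hμ : Stationary x₀ y₀ p₀ p₁ μ) (hx : x ∈ Ioo (0 : ℝ) 1) {φ : ℝ → ℝ}
    (hφc : ContinuousOn φ (Ioo 0 1)) {M : ℝ} (hφ : ∀ t ∈ Ioo (0 : ℝ) 1, |φ t| ≤ M) :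
    ∀ᵐ ω ∂(Pm x), Tendsto
      (fun n : ℕ => (∑ k ∈ Finset.range n, φ (iter x₀ y₀ ω (k + 1) x)) / n) atTop
      (𝓝 (∫ t, φ t ∂μ)) := by
  have := isProbabilityMeasure_kernel hPm hx
  have hs := isSystem_prob_fb hA h3
  obtain ⟨V, q, B, hV⟩ := exists_isLyapunov hA h3 h4
  set u : ℕ → ℝ → ℝ := fun m => (avg (prob p₀ p₁) (fb x₀ y₀))^[m] φ with hu
  have hub : ∀ m, ∀ t ∈ Ioo (0 : ℝ) 1, |u m t| ≤ M := fun m t ht =>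
    abs_iterate_avg_le hA h3 hφ m ht
  have hincV := ae_tendsto_average_increment hPm hs hx
    (hV.integral_sq_iter_le hA h3 hPm hx)
  have hincu : ∀ m, ∀ᵐ ω ∂(Pm x), Tendsto (fun n : ℕ => (∑ k ∈ Finset.range n,
      (u m (iter x₀ y₀ ω (k + 1) x) - u (m + 1) (iter x₀ y₀ ω k x))) / n) atTop (𝓝 0) := by
    intro m
    simp only [hu, Function.iterate_succ_apply']
    refine ae_tendsto_average_increment hPm hs hx (C := M ^ 2) fun n => ?_
    refine (integral_mono_of_nonneg (ae_of_all _ fun ω => sq_nonneg _)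
      (integrable_const (M ^ 2)) (ae_of_all _ fun ω => ?_)).trans_eq (by simp)
    exact sq_le_sq' (abs_le.1 (hub m _ (iter_mem hs.mapsTo ω n hx))).1
      (abs_le.1 (hub m _ (iter_mem hs.mapsTo ω n hx))).2
  filter_upwards [hincV, ae_all_iff.2 hincu] with ω hωV hωu
  have hX : ∀ n, iter x₀ y₀ ω n x ∈ Ioo (0 : ℝ) 1 := fun n => iter_mem hs.mapsTo ω n hx
  set X : ℕ → ℝ := fun n => iter x₀ y₀ ω n x
  set A : (ℝ → ℝ) → ℕ → ℝ := fun ψ n => (∑ k ∈ Finset.range n, ψ (X (k + 1))) / n with hAdef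
  have hA0 : ∀ m, Tendsto (fun n => A φ n - A (u m) n) atTop (𝓝 0) := by
    intro m
    induction m with
    | zero => simp [hu]
    | succ m ih =>
      have h := tendsto_average_sub_of_increment (f := fun n => u m (X n))
        (g := fun n => u (m + 1) (X n)) (fun n => hub (m + 1) _ (hX n)) (hωu m)
      have := ih.add h
      rw [add_zero] at this
      exact this.congr fun n => sub_add_sub_cancel _ _ _
  obtain ⟨L, hL⟩ := exists_eventually_average_le_of_increment (f := fun n => V (X n))
    (fun n => zero_le_one.trans (hV.one_le _ (hX n))) hV.q_nonneg hV.q_lt_one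
    (fun n => hV.drift _ (hX n)) hωV
  rw [Metric.tendsto_nhds]
  intro ε hε
  set η := ε / (2 * (|L| + 1)) with hη
  have hη0 : 0 < η := by positivity
  obtain ⟨m, hm⟩ := hμ.exists_abs_iterate_avg_sub_le hA h2 h3 hV hφc hφ hη0
  have hηL : η * L < ε / 2 := by
    have e : ε / 2 = η * (|L| + 1) := by
      rw [hη]
      field_simp
    rw [e]
    have := le_abs_self L
    gcongr
    linarith
  filter_upwards [(Metric.tendsto_nhds.1 (hA0 m)) (ε / 2) (half_pos hε), hL,
    eventually_ge_atTop 1] with n h5 h6 hn1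
  have hn0 : (0 : ℝ) < n := by exact_mod_cast hn1
  rw [dist_zero_right, Real.norm_eq_abs] at h5
  have h7 : |A (u m) n - ∫ t, φ t ∂μ| ≤ η * L := by
    calc |A (u m) n - ∫ t, φ t ∂μ|
        = |∑ k ∈ Finset.range n, (u m (X (k + 1)) - ∫ t, φ t ∂μ)| / n := by
          rw [← abs_of_pos hn0, ← abs_div, Finset.sum_sub_distrib,
            Finset.sum_const, Finset.card_range, nsmul_eq_mul, sub_div,
            mul_div_cancel_left₀ _ hn0.ne']
      _ ≤ (∑ k ∈ Finset.range n, η * V (X (k + 1))) / n := by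
          gcongr
          exact (Finset.abs_sum_le_sum_abs _ _).trans
            (Finset.sum_le_sum fun k _ => hm _ (hX (k + 1)))
      _ = η * ((∑ k ∈ Finset.range n, V (X (k + 1))) / n) := by
          rw [← Finset.mul_sum, mul_div_assoc]
      _ ≤ η * L := by gcongr
  rw [Real.dist_eq]
  calc |A φ n - ∫ t, φ t ∂μ| ≤ |A φ n - A (u m) n| + |A (u m) n - ∫ t, φ t ∂μ| :=
        abs_sub_le _ _ _
    _ < ε := by linarith

end StrongLaw

end AM

/-- Strong Law of Large Numbers: for every `x ∈ (0,1)` and every bounded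
continuous `φ : (0,1) → ℝ`, for `ℙ_x`-a.e. `ω`, `(1/n) ∑_(k=1)^n φ(f^k_ω(x)) → ∫ φ dμ⋆`. -/
theorem stmt2 (x₀ y₀ : ℝ) (p₀ p₁ : ℝ → ℝ)
    (hA1 : AM.A1 x₀ y₀) (hA2 : AM.A2 p₀ p₁) (hA3 : AM.A3 p₀ p₁) (hA4 : AM.A4 x₀ y₀ p₀ p₁)
    (Pm : ℝ → MeasureTheory.Measure (ℕ → Bool)) (hPm : AM.IsKernel x₀ y₀ p₀ p₁ Pm)
    (μstar : MeasureTheory.Measure ℝ) (hstar : AM.Stationary x₀ y₀ p₀ p₁ μstar)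
    (x : ℝ) (hx : x ∈ Set.Ioo (0:ℝ) 1)
    (φ : ℝ → ℝ) (hφc : ContinuousOn φ (Set.Ioo 0 1))
    (hφb : ∃ K : ℝ, ∀ t ∈ Set.Ioo (0:ℝ) 1, |φ t| ≤ K) :
    ∀ᵐ ω ∂(Pm x), Filter.Tendsto
      (fun n : ℕ => (∑ k ∈ Finset.range n, φ (AM.iter x₀ y₀ ω (k + 1) x)) / (n : ℝ))
      Filter.atTop (nhds (∫ t in Set.Ioo (0:ℝ) 1, φ t ∂μstar)) := by
  obtain ⟨K, hK⟩ := hφb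
  have := hstar.1
  rw [Measure.restrict_eq_self_of_ae_mem hstar.ae_mem]
  exact hstar.ae_tendsto_average hA1 hA2 hA3 hA4 hPm hx hφc hK
end

section
/- Under assumptions (A1)–(A4) there exist M ≥ 1 and α ∈ (0,1) such that the class 𝒫_{M,α} is invariant under the Markov operator P: if μ ∈ 𝒫_{M,α} then Pμ ∈ 𝒫_{M,α}. -/
/-
Formalization of the Alsedà–Misiurewicz system setup:
`f0, f1` are the piecewise-linear interval homeomorphisms, `iter` the random
iteration along ω ∈ Σ = {0,1}^ℕ, `IsKernel` characterises the family x ↦ ℙ_x by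
its values on cylinder sets, `Pop` is the Markov operator (as a set function),
`Stationary` expresses P-invariance for probability measures on (0,1), `U` is
the dual operator, and `A1`–`A4` are the assumptions of the paper.
-/

open MeasureTheory Filter Set
open scoped ENNReal Topology

namespace AM

theorem eventually_weighted_rpow_neg_lt_one {a b q : ℝ} (ha : 0 < a) (hb : 0 < b)
    (h : 0 < (1 - q) * Real.log b + q * Real.log a) :
    ∀ᶠ α in 𝓝[>] (0 : ℝ), (1 - q) * b ^ (-α) + q * a ^ (-α) < 1 := by
  have hd : ∀ c : ℝ, 0 < c →
      HasDerivAt (fun α : ℝ => c ^ (-α)) (-Real.log c) 0 := fun c hc => by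
    simpa using (hasDerivAt_neg (0 : ℝ)).const_rpow hc
  have hD := ((hd b hb).const_mul (1 - q)).add ((hd a ha).const_mul q)
  have hs := (hasDerivAt_iff_tendsto_slope.1 hD).mono_left
    (nhdsWithin_mono 0 (s := Ioi 0) (fun x (hx : 0 < x) => hx.ne'))
  have hneg : (1 - q) * -Real.log b + q * -Real.log a < 0 := by linarith
  filter_upwards [hs.eventually (gt_mem_nhds hneg), self_mem_nhdsWithin]
    with α hα hpos
  rw [slope_def_field, sub_zero, div_lt_iff₀ hpos] at hα
  simp at hα
  linarith

theorem exists_weight_bound {p : ℝ → ℝ} {e la lb : ℝ} (hp : ContinuousOn p (Icc 0 1))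
    (he : e ∈ Icc (0 : ℝ) 1) (h0 : 0 < p e) (h1 : p e < 1)
    (h : 0 < (1 - p e) * lb + p e * la) :
    ∃ q, 0 ≤ q ∧ q ≤ 1 ∧ 0 < (1 - q) * lb + q * la ∧
      ∃ η > 0, ∀ z ∈ Icc (0 : ℝ) 1, |z - e| < η → p z ≤ q := by
  have hc : Continuous fun q : ℝ => (1 - q) * lb + q * la := by fun_prop
  have hev : ∀ᶠ q in 𝓝[>] (p e), 0 < (1 - q) * lb + q * la ∧ q < 1 :=
    nhdsWithin_le_nhds ((hc.continuousAt.eventually (lt_mem_nhds h)).and (gt_mem_nhds h1))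
  obtain ⟨q, ⟨hq, hq1⟩, hpq⟩ := (hev.and self_mem_nhdsWithin).exists
  have hpq : p e < q := hpq
  refine ⟨q, (h0.trans hpq).le, hq1.le, hq, ?_⟩
  obtain ⟨η, hη, H⟩ := Metric.mem_nhdsWithin_iff.1 ((hp e he).eventually (gt_mem_nhds hpq))
  exact ⟨η, hη, fun z hz hze => (H ⟨by simpa [Real.dist_eq] using hze, hz⟩).le⟩

theorem lintegral_add_lintegral_le {μ : Measure ℝ} {p p' : ℝ → ℝ} {A B : Set ℝ} {q : ℝ}
    (hA : MeasurableSet A) (hB : MeasurableSet B) (hAB : A ⊆ B) (hBI : B ⊆ Icc 0 1)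
    (hp : ContinuousOn p (Icc 0 1)) (hsum : ∀ x ∈ B, p x + p' x = 1)
    (hp0 : ∀ x ∈ B, 0 ≤ p x) (hp'0 : ∀ x ∈ B, 0 ≤ p' x)
    (hq0 : 0 ≤ q) (hq1 : q ≤ 1) (hpq : ∀ x ∈ B, p x ≤ q) :
    (∫⁻ x in B, ENNReal.ofReal (p x) ∂μ) + ∫⁻ x in A, ENNReal.ofReal (p' x) ∂μ ≤
      ENNReal.ofReal (1 - q) * μ A + ENNReal.ofReal q * μ B := by
  have hone : ENNReal.ofReal (1 - q) + ENNReal.ofReal q = 1 := by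
    rw [← ENNReal.ofReal_add (by linarith) hq0]; simp
  have hmeas : AEMeasurable (fun x => ENNReal.ofReal (p x)) (μ.restrict A) :=
    ((hp.mono (hAB.trans hBI)).aemeasurable hA).ennreal_ofReal
  have hAint : (∫⁻ x in A, ENNReal.ofReal (p x) ∂μ) + ∫⁻ x in A, ENNReal.ofReal (p' x) ∂μ
      = μ A := by
    rw [← lintegral_add_left' hmeas, ← setLIntegral_one]
    refine setLIntegral_congr_fun hA fun x hx => ?_
    simp only [← ENNReal.ofReal_add (hp0 x (hAB hx)) (hp'0 x (hAB hx)), hsum x (hAB hx),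
      ENNReal.ofReal_one]
  have hdiff : ∫⁻ x in B \ A, ENNReal.ofReal (p x) ∂μ ≤ ENNReal.ofReal q * μ (B \ A) := by
    rw [← setLIntegral_const]
    exact setLIntegral_mono' (hB.diff hA) fun x hx => ENNReal.ofReal_le_ofReal (hpq x hx.1)
  have hsplit : ∫⁻ x in B, ENNReal.ofReal (p x) ∂μ =
      (∫⁻ x in A, ENNReal.ofReal (p x) ∂μ) + ∫⁻ x in B \ A, ENNReal.ofReal (p x) ∂μ := by
    have h := lintegral_inter_add_sdiff (μ := μ) (fun x => ENNReal.ofReal (p x)) B hA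
    rw [inter_eq_self_of_subset_right hAB] at h
    exact h.symm
  have hμB : μ B = μ A + μ (B \ A) := by
    have h := measure_inter_add_sdiff (μ := μ) B hA
    rw [inter_eq_self_of_subset_right hAB] at h
    exact h.symm
  calc _ = μ A + ∫⁻ x in B \ A, ENNReal.ofReal (p x) ∂μ := by
        rw [hsplit, ← hAint]; ring
    _ ≤ (ENNReal.ofReal (1 - q) + ENNReal.ofReal q) * μ A + ENNReal.ofReal q * μ (B \ A) := by
        rw [hone, one_mul]; gcongr
    _ = _ := by rw [hμB]; ring

theorem ofReal_weighted_le {u v : ℝ≥0∞} {a b q M x α : ℝ} (ha : 0 < a) (hb : 0 < b)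
    (hq0 : 0 ≤ q) (hq1 : q ≤ 1) (hM : 0 ≤ M) (hx : 0 < x)
    (hα : (1 - q) * b ^ (-α) + q * a ^ (-α) < 1)
    (hu : u ≤ ENNReal.ofReal (M * (x / b) ^ α)) (hv : v ≤ ENNReal.ofReal (M * (x / a) ^ α)) :
    ENNReal.ofReal (1 - q) * u + ENNReal.ofReal q * v ≤ ENNReal.ofReal (M * x ^ α) := by
  have hq : 0 ≤ 1 - q := by linarith
  have hx' : 0 ≤ M * x ^ α := by positivity
  calc _ ≤ ENNReal.ofReal (1 - q) * ENNReal.ofReal (M * (x / b) ^ α) +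
        ENNReal.ofReal q * ENNReal.ofReal (M * (x / a) ^ α) := by gcongr
    _ = ENNReal.ofReal (M * x ^ α * ((1 - q) * b ^ (-α) + q * a ^ (-α))) := by
        rw [← ENNReal.ofReal_mul hq, ← ENNReal.ofReal_mul hq0,
          ← ENNReal.ofReal_add (by positivity) (by positivity),
          Real.div_rpow hx.le hb.le, Real.div_rpow hx.le ha.le, Real.rpow_neg hb.le,
          Real.rpow_neg ha.le]
        congr 1
        ring
    _ ≤ _ := ENNReal.ofReal_le_ofReal (mul_le_of_le_one_right hx' hα.le)

theorem Pop_le_one {x₀ y₀ : ℝ} {p₀ p₁ : ℝ → ℝ} (hA3 : A3 p₀ p₁) {μ : Measure ℝ}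
    [IsProbabilityMeasure μ] (hμ : μ (Ioo 0 1) = 1) (A : Set ℝ) :
    Pop x₀ y₀ p₀ p₁ μ A ≤ 1 := by
  obtain ⟨hc, -, h⟩ := hA3
  have hres : μ.restrict (Ioo 0 1) = μ :=
    Measure.restrict_eq_self_of_ae_mem ((prob_compl_eq_zero_iff measurableSet_Ioo).2 hμ)
  have hI : ∀ x ∈ Ioo (0 : ℝ) 1, _ := fun x hx => h x (Ioo_subset_Icc_self hx)
  have key := lintegral_add_lintegral_le (μ := μ) (p := p₀) (p' := p₁) (q := 1)
    measurableSet_Ioo measurableSet_Ioo Subset.rfl Ioo_subset_Icc_self hc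
    (fun x hx => (hI x hx).1) (fun x hx => (hI x hx).2.1.le) (fun x hx => (hI x hx).2.2.2.1.le)
    zero_le_one le_rfl (fun x hx => (hI x hx).2.2.1.le)
  simp only [hres, hμ, sub_self, ENNReal.ofReal_zero, zero_mul, zero_add, ENNReal.ofReal_one,
    one_mul] at key
  exact (add_le_add (setLIntegral_le_lintegral _ _) (setLIntegral_le_lintegral _ _)).trans key

theorem mem_Ioo_of_f0_mem {x₀ y₀ x z : ℝ} (h : A1 x₀ y₀) (hx : x ≤ y₀)
    (hz : f0 x₀ y₀ z ∈ Ioo 0 x) : z ∈ Ioo 0 (x / (y₀ / x₀)) := by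
  obtain ⟨h1, h2, h3, h4⟩ := h
  have ha : 0 < y₀ / x₀ := div_pos (by linarith) (by linarith)
  unfold f0 at hz
  split_ifs at hz with hzx
  · exact ⟨pos_of_mul_pos_right hz.1 ha.le, by rw [lt_div_iff₀ ha, mul_comm]; exact hz.2⟩
  · have hlt : (1 - y₀) / (1 - x₀) * (x₀ - 1) < (1 - y₀) / (1 - x₀) * (z - 1) :=
      mul_lt_mul_of_pos_left (by linarith) (div_pos (by linarith) (by linarith))
    have heq : (1 - y₀) / (1 - x₀) * (x₀ - 1) = y₀ - 1 := by
      have : 1 - x₀ ≠ 0 := by linarith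
      field_simp
      ring
    linarith [hz.2]

theorem mem_Ioo_of_f0_mem_one {x₀ y₀ x z : ℝ} (h : A1 x₀ y₀) (hx : x ≤ 1 - y₀)
    (hz : f0 x₀ y₀ z ∈ Ioo (1 - x) 1) :
    z ∈ Ioo (1 - x / ((1 - y₀) / (1 - x₀))) 1 := by
  obtain ⟨h1, h2, h3, h4⟩ := h
  have ha : 0 < (1 - y₀) / (1 - x₀) := div_pos (by linarith) (by linarith)
  unfold f0 at hz
  split_ifs at hz with hzx
  · have hle : y₀ / x₀ * z ≤ y₀ / x₀ * x₀ :=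
      mul_le_mul_of_nonneg_left hzx (div_pos (by linarith) (by linarith)).le
    rw [div_mul_cancel₀ _ (by linarith)] at hle
    linarith [hz.1]
  · constructor
    · have : 1 - z < x / ((1 - y₀) / (1 - x₀)) := by
        rw [lt_div_iff₀ ha]
        linarith [hz.1]
      linarith
    · have : 0 < 1 - z := pos_of_mul_pos_right (by linarith [hz.2]) ha.le
      linarith

theorem mem_Ioo_of_f1_mem {x₀ y₀ x z : ℝ} (h : A1 x₀ y₀) (hx : x ≤ 1 - y₀)
    (hz : f1 x₀ y₀ z ∈ Ioo 0 x) : z ∈ Ioo 0 (x / ((1 - y₀) / (1 - x₀))) := by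
  have := mem_Ioo_of_f0_mem_one (z := 1 - z) h hx
    ⟨by unfold f1 at hz; linarith [hz.2], by unfold f1 at hz; linarith [hz.1]⟩
  exact ⟨by linarith [this.2], by linarith [this.1]⟩

theorem mem_Ioo_of_f1_mem_one {x₀ y₀ x z : ℝ} (h : A1 x₀ y₀) (hx : x ≤ y₀)
    (hz : f1 x₀ y₀ z ∈ Ioo (1 - x) 1) : z ∈ Ioo (1 - x / (y₀ / x₀)) 1 := by
  have := mem_Ioo_of_f0_mem (z := 1 - z) h hx
    ⟨by unfold f1 at hz; linarith [hz.2], by unfold f1 at hz; linarith [hz.1]⟩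
  exact ⟨by linarith [this.2], by linarith [this.1]⟩

end AM

/-- there exist `M ≥ 1` and `α ∈ (0,1)` such that the class `𝒫_(M,α)` is
invariant under the Markov operator `P`. -/
theorem stmt3 (x₀ y₀ : ℝ) (p₀ p₁ : ℝ → ℝ)
    (hA1 : AM.A1 x₀ y₀) (hA2 : AM.A2 p₀ p₁) (hA3 : AM.A3 p₀ p₁) (hA4 : AM.A4 x₀ y₀ p₀ p₁) :
    ∃ M : ℝ, 1 ≤ M ∧ ∃ α : ℝ, α ∈ Set.Ioo (0:ℝ) 1 ∧
      ∀ μ : MeasureTheory.Measure ℝ, MeasureTheory.IsProbabilityMeasure μ →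
        μ (Set.Ioo 0 1) = 1 →
        (∀ x ∈ Set.Ioo (0:ℝ) 1,
          μ (Set.Ioo 0 x) ≤ ENNReal.ofReal (M * x ^ α) ∧
          μ (Set.Ioo (1 - x) 1) ≤ ENNReal.ofReal (M * x ^ α)) →
        (∀ x ∈ Set.Ioo (0:ℝ) 1,
          AM.Pop x₀ y₀ p₀ p₁ μ (Set.Ioo 0 x) ≤ ENNReal.ofReal (M * x ^ α) ∧
          AM.Pop x₀ y₀ p₀ p₁ μ (Set.Ioo (1 - x) 1) ≤ ENNReal.ofReal (M * x ^ α)) := by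
  obtain ⟨h1, h2, h3, h4⟩ := id hA1
  obtain ⟨hc0, hc1, hp⟩ := id hA3
  obtain ⟨hL0, hL1⟩ := hA4
  set a := y₀ / x₀ with ha_def
  set b := (1 - y₀) / (1 - x₀) with hb_def
  have ha : 0 < a := div_pos (by linarith) (by linarith)
  have ha1 : a < 1 := (div_lt_one (by linarith)).2 h4
  have hb1 : 1 < b := (one_lt_div (by linarith)).2 (by linarith)
  have hb : 0 < b := one_pos.trans hb1
  have hI0 : (0 : ℝ) ∈ Icc (0 : ℝ) 1 := by simp
  have hI1 : (1 : ℝ) ∈ Icc (0 : ℝ) 1 := by simp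
  obtain ⟨q, hq0, hq1, hql, η, hη, hqη⟩ := AM.exists_weight_bound (la := Real.log a)
    (lb := Real.log b) hc0 hI0 (hp 0 hI0).2.1 (hp 0 hI0).2.2.1
    (by rw [← eq_sub_of_add_eq' (hp 0 hI0).1]; linarith)
  obtain ⟨r, hr0, hr1, hrl, ζ, hζ, hrζ⟩ := AM.exists_weight_bound (la := Real.log a)
    (lb := Real.log b) hc1 hI1 (hp 1 hI1).2.2.2.1 (hp 1 hI1).2.2.2.2
    (by rw [← eq_sub_of_add_eq (hp 1 hI1).1]; linarith)
  obtain ⟨α, ⟨⟨hαq, hαr⟩, hα1⟩, hα0⟩ :=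
    (((AM.eventually_weighted_rpow_neg_lt_one ha hb hql).and
      (AM.eventually_weighted_rpow_neg_lt_one ha hb hrl)).and
      (nhdsWithin_le_nhds (gt_mem_nhds one_pos)) |>.and self_mem_nhdsWithin).exists
  have hα0 : 0 < α := hα0
  obtain ⟨δ, hδ, hδy, hδη, hδζ, hδ1⟩ :
      ∃ δ > 0, δ ≤ 1 - y₀ ∧ δ ≤ η * a ∧ δ ≤ ζ * a ∧ δ ≤ 1 * a :=
    ⟨min (min (1 - y₀) (η * a)) (min (ζ * a) (1 * a)), by
      have : 0 < 1 - y₀ := by linarith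
      positivity, by simp, by simp, by simp, by simp⟩
  have hM : 1 ≤ δ ^ (-α) :=
    Real.one_le_rpow_of_pos_of_le_one_of_nonpos hδ (by linarith) (by linarith)
  refine ⟨δ ^ (-α), hM, α, ⟨hα0, hα1⟩, fun μ hμ hμI hμb x hx => ?_⟩
  rcases le_or_gt δ x with hδx | hxδ
  · have hle : 1 ≤ ENNReal.ofReal (δ ^ (-α) * x ^ α) := by
      rw [ENNReal.one_le_ofReal]
      calc 1 = δ ^ (-α) * δ ^ α := by rw [← Real.rpow_add hδ]; simp
        _ ≤ _ := by gcongr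
    exact ⟨(AM.Pop_le_one hA3 hμI _).trans hle, (AM.Pop_le_one hA3 hμI _).trans hle⟩
  have hxη : x / a < η := (div_lt_iff₀ ha).2 (hxδ.trans_le hδη)
  have hxζ : x / a < ζ := (div_lt_iff₀ ha).2 (hxδ.trans_le hδζ)
  have hxa1 : x / a < 1 := (div_lt_iff₀ ha).2 (hxδ.trans_le hδ1)
  have hxb : x / b ≤ x / a := div_le_div_of_nonneg_left hx.1.le ha (by linarith)
  have hxaI : x / a ∈ Ioo (0 : ℝ) 1 := ⟨div_pos hx.1 ha, hxa1⟩
  have hxbI : x / b ∈ Ioo (0 : ℝ) 1 := ⟨div_pos hx.1 hb, hxb.trans_lt hxa1⟩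
  have hB0 : Ioo 0 (x / a) ⊆ Icc (0 : ℝ) 1 := fun z hz => ⟨hz.1.le, (hz.2.trans hxa1).le⟩
  have hB1 : Ioo (1 - x / a) 1 ⊆ Icc (0 : ℝ) 1 := fun z hz => ⟨by linarith [hz.1], hz.2.le⟩
  constructor
  · refine le_trans (add_le_add (lintegral_mono_set fun z hz =>
      AM.mem_Ioo_of_f0_mem hA1 (by linarith) hz) (lintegral_mono_set fun z hz =>
      AM.mem_Ioo_of_f1_mem hA1 (by linarith) hz)) ?_
    refine (AM.lintegral_add_lintegral_le (q := q) measurableSet_Ioo measurableSet_Ioo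
      (Ioo_subset_Ioo_right hxb) hB0 hc0 (fun z hz => (hp z (hB0 hz)).1)
      (fun z hz => (hp z (hB0 hz)).2.1.le) (fun z hz => (hp z (hB0 hz)).2.2.2.1.le) hq0 hq1
      fun z hz => hqη z (hB0 hz) (by
        rw [sub_zero, abs_of_pos hz.1]; exact hz.2.trans hxη)).trans ?_
    exact AM.ofReal_weighted_le ha hb hq0 hq1 (by linarith) hx.1 hαq (hμb _ hxbI).1 (hμb _ hxaI).1
  · unfold AM.Pop
    rw [add_comm]
    refine le_trans (add_le_add (lintegral_mono_set fun z hz =>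
      AM.mem_Ioo_of_f1_mem_one hA1 (by linarith) hz) (lintegral_mono_set fun z hz =>
      AM.mem_Ioo_of_f0_mem_one hA1 (by linarith) hz)) ?_
    refine (AM.lintegral_add_lintegral_le (q := r) measurableSet_Ioo measurableSet_Ioo
      (Ioo_subset_Ioo_left (sub_le_sub_left hxb 1)) hB1 hc1
      (fun z hz => (add_comm _ _).trans (hp z (hB1 hz)).1)
      (fun z hz => (hp z (hB1 hz)).2.2.2.1.le) (fun z hz => (hp z (hB1 hz)).2.1.le) hr0 hr1
      fun z hz => hrζ z (hB1 hz) (by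
        rw [abs_sub_comm, abs_of_pos (by linarith [hz.2])]; linarith [hz.1])).trans ?_
    exact AM.ofReal_weighted_le ha hb hr0 hr1 (by linarith) hx.1 hαr (hμb _ hxbI).2 (hμb _ hxaI).2
end
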